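/- Let R₁ ↦ R₂ be an arbitrary elementary move of rectangular diagrams of links, and let R₂ ↦ R₃ be a stabilization. Then there is a chain of elementary moves R₁ ↦ R₂' ↦ R₃' ↦ ⋯ ↦ R₃ from R₁ to R₃ such that: the move R₁ ↦ R₂' is a stabilization having the same oriented type as R₂ ↦ R₃ and modifying the connected component with the same number; the move R₂' ↦ R₃' does the same thing as R₁ ↦ R₂ does; and all remaining moves of the chain are exchange moves. -/

import Mathlib

open scoped Real

noncomputable section

namespace RectDiag

instance : DecidableEq Real.Angle := Classical.decEq _

/-- The torus `T² = S¹ × S¹` with angular coordinates `(θ, φ)`. -/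
abbrev Torus := Real.Angle × Real.Angle

/-- The length of the arc running from `x` to `y` in the positive direction. -/
def arcLen (x y : Real.Angle) : ℝ :=
  if (y - x).toReal < 0 then (y - x).toReal + 2 * Real.pi else (y - x).toReal

/-- The closed arc `[x;y]` running from `x` to `y` in the positive direction. -/
def Arc (x y : Real.Angle) : Set Real.Angle :=
  {z | ∃ t : ℝ, 0 ≤ t ∧ t ≤ arcLen x y ∧ z = x + (t : Real.Angle)}

/-- The open arc `(x;y)`, the interior of `[x;y]`. -/
def ArcInt (x y : Real.Angle) : Set Real.Angle :=
  {z | ∃ t : ℝ, 0 < t ∧ t < arcLen x y ∧ z = x + (t : Real.Angle)}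

/-- Every meridian `{θ}×S¹` contains no or exactly two points of `V`, of opposite signs. -/
def MeridianOK (V : Finset Torus) (sgn : Torus → Bool) : Prop :=
  ∀ θ : Real.Angle, (∀ v ∈ V, v.1 ≠ θ) ∨
    ∃ u w, u ∈ V ∧ w ∈ V ∧ u ≠ w ∧ u.1 = θ ∧ w.1 = θ ∧ sgn u ≠ sgn w ∧
      ∀ x ∈ V, x.1 = θ → x = u ∨ x = w

/-- Every longitude `S¹×{φ}` contains no or exactly two points of `V`, of opposite signs. -/
def LongitudeOK (V : Finset Torus) (sgn : Torus → Bool) : Prop :=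
  ∀ φ : Real.Angle, (∀ v ∈ V, v.2 ≠ φ) ∨
    ∃ u w, u ∈ V ∧ w ∈ V ∧ u ≠ w ∧ u.2 = φ ∧ w.2 = φ ∧ sgn u ≠ sgn w ∧
      ∀ x ∈ V, x.2 = φ → x = u ∨ x = w

/-- `V` with sign assignment `sgn` satisfies the conditions of a rectangular diagram. -/
def IsDiagSet (V : Finset Torus) (sgn : Torus → Bool) : Prop :=
  MeridianOK V sgn ∧ LongitudeOK V sgn

/-- `S` is a connected component of `V`: a minimal nonempty subset of `V` that is itself a
rectangular diagram of a link (with the inherited signs). -/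
def IsComponent (V : Finset Torus) (sgn : Torus → Bool) (S : Finset Torus) : Prop :=
  S ⊆ V ∧ S.Nonempty ∧ IsDiagSet S sgn ∧
    ∀ S' ⊆ S, S'.Nonempty → IsDiagSet S' sgn → S' = S

/-- An oriented rectangular diagram of a link with numbered connected components:
a finite subset of the torus with a sign assignment satisfying the meridian/longitude
conditions, together with a numbering of the vertices which is constant exactly on
connected components. -/
structure RectDiagram where
  verts : Finset Torus
  sgn : Torus → Bool
  comp : Torus → ℕ
  diag : IsDiagSet verts sgn
  comp_eq_iff : ∀ u ∈ verts, ∀ v ∈ verts,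
    (comp u = comp v ↔ ∃ S, IsComponent verts sgn S ∧ u ∈ S ∧ v ∈ S)

/-- `{u,v}` is a (vertical or horizontal) edge of the diagram `R`. -/
def IsEdge (R : RectDiagram) (u v : Torus) : Prop :=
  u ∈ R.verts ∧ v ∈ R.verts ∧ u ≠ v ∧ (u.1 = v.1 ∨ u.2 = v.2)

/-- The four corner points `{θ₁,θ₂}×{φ₁,φ₂}`. -/
def corners (t1 t2 p1 p2 : Real.Angle) : Finset Torus :=
  {(t1, p1), (t1, p2), (t2, p1), (t2, p2)}

/-- The rectangle `[θ₁;θ₂]×[φ₁;φ₂] ⊆ T²`. -/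
def RectSet (t1 t2 p1 p2 : Real.Angle) : Set Torus :=
  {p | p.1 ∈ Arc t1 t2 ∧ p.2 ∈ Arc p1 p2}

/-- `R₁ ↦ R₂` is an elementary move associated with the rectangle `[θ₁;θ₂]×[φ₁;φ₂]`. -/
def IsElemMoveWith (R₁ R₂ : RectDiagram) (t1 t2 p1 p2 : Real.Angle) : Prop :=
  t1 ≠ t2 ∧ p1 ≠ p2 ∧
  symmDiff R₁.verts R₂.verts = corners t1 t2 p1 p2 ∧
  (∃ u v : Torus, u ∈ symmDiff R₁.verts R₂.verts ∧ v ∈ symmDiff R₁.verts R₂.verts ∧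
      (IsEdge R₁ u v ∨ IsEdge R₂ u v)) ∧
  ¬ R₁.verts ⊆ R₂.verts ∧ ¬ R₂.verts ⊆ R₁.verts ∧
  RectSet t1 t2 p1 p2 ∩ (↑R₁.verts ∪ ↑R₂.verts) = ↑(corners t1 t2 p1 p2) ∧
  ∀ v ∈ R₁.verts ∩ R₂.verts, R₁.sgn v = R₂.sgn v ∧ R₁.comp v = R₂.comp v

/-- `R₁ ↦ R₂` is an elementary move. -/
def IsElemMove (R₁ R₂ : RectDiagram) : Prop :=
  ∃ t1 t2 p1 p2 : Real.Angle, IsElemMoveWith R₁ R₂ t1 t2 p1 p2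

/-- An exchange move. -/
def IsExchange (R₁ R₂ : RectDiagram) : Prop :=
  IsElemMove R₁ R₂ ∧ R₂.verts.card = R₁.verts.card

/-- A stabilization. -/
def IsStab (R₁ R₂ : RectDiagram) : Prop :=
  IsElemMove R₁ R₂ ∧ R₂.verts.card = R₁.verts.card + 2

/-- A destabilization. -/
def IsDestab (R₁ R₂ : RectDiagram) : Prop :=
  IsElemMove R₁ R₂ ∧ R₁.verts.card = R₂.verts.card + 2

/-- A stabilization associated with a given rectangle. -/
def IsStabWith (R₁ R₂ : RectDiagram) (t1 t2 p1 p2 : Real.Angle) : Prop :=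
  IsElemMoveWith R₁ R₂ t1 t2 p1 p2 ∧ R₂.verts.card = R₁.verts.card + 2

/-- The type I corner condition: `R₁ ∩ V ⊆ {(θ₁,φ₁),(θ₂,φ₂)}`. -/
def TypeICornerCond (R₁ : RectDiagram) (t1 t2 p1 p2 : Real.Angle) : Prop :=
  ∀ v ∈ R₁.verts, v ∈ corners t1 t2 p1 p2 → v = (t1, p1) ∨ v = (t2, p2)

/-- The type II corner condition: `R₁ ∩ V ⊆ {(θ₁,φ₂),(θ₂,φ₁)}`. -/
def TypeIICornerCond (R₁ : RectDiagram) (t1 t2 p1 p2 : Real.Angle) : Prop :=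
  ∀ v ∈ R₁.verts, v ∈ corners t1 t2 p1 p2 → v = (t1, p2) ∨ v = (t2, p1)

/-- `R₁ ↦ R₂` is a type I stabilization. -/
def IsTypeIStab (R₁ R₂ : RectDiagram) : Prop :=
  ∃ t1 t2 p1 p2, IsStabWith R₁ R₂ t1 t2 p1 p2 ∧ TypeICornerCond R₁ t1 t2 p1 p2

/-- `R₁ ↦ R₂` is a type II stabilization. -/
def IsTypeIIStab (R₁ R₂ : RectDiagram) : Prop :=
  ∃ t1 t2 p1 p2, IsStabWith R₁ R₂ t1 t2 p1 p2 ∧ TypeIICornerCond R₁ t1 t2 p1 p2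

/-- `R₁ ↦ R₂` is a type I destabilization. -/
def IsTypeIDestab (R₁ R₂ : RectDiagram) : Prop := IsTypeIStab R₂ R₁

/-- `R₁ ↦ R₂` is a type II destabilization. -/
def IsTypeIIDestab (R₁ R₂ : RectDiagram) : Prop := IsTypeIIStab R₂ R₁

/-- The four oriented types `→I`, `←I`, `→II`, `←II` of (de)stabilizations. -/
inductive OType
  | posI
  | negI
  | posII
  | negII
deriving DecidableEq

/-- Whether an oriented type is of (unoriented) type I. -/
def OType.isI : OType → Bool
  | .posI => true
  | .negI => true
  | _ => false

/-- `R₁ ↦ R₂` is a stabilization of the given oriented type. -/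
def IsStabOfOType (R₁ R₂ : RectDiagram) (t : OType) : Prop :=
  ∃ t1 t2 p1 p2, IsStabWith R₁ R₂ t1 t2 p1 p2 ∧
    ∃ p0, (p0 = p1 ∨ p0 = p2) ∧ (t1, p0) ∈ R₂.verts ∧ (t2, p0) ∈ R₂.verts ∧
      (match t with
        | .posI => TypeICornerCond R₁ t1 t2 p1 p2 ∧ R₂.sgn (t2, p0) = true
        | .negI => TypeICornerCond R₁ t1 t2 p1 p2 ∧ R₂.sgn (t2, p0) = false
        | .posII => TypeIICornerCond R₁ t1 t2 p1 p2 ∧ R₂.sgn (t2, p0) = true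
        | .negII => TypeIICornerCond R₁ t1 t2 p1 p2 ∧ R₂.sgn (t2, p0) = false)

/-- `R₁ ↦ R₂` is a destabilization of the given oriented type. -/
def IsDestabOfOType (R₁ R₂ : RectDiagram) (t : OType) : Prop := IsStabOfOType R₂ R₁ t

/-- The move `R₁ ↦ R₂` is performed on (modifies) the connected component number `i`. -/
def ModifiesComp (R₁ R₂ : RectDiagram) (i : ℕ) : Prop :=
  ∃ v ∈ R₁.verts, v ∉ R₂.verts ∧ R₁.comp v = i

/-- The kind of an elementary move: an exchange, a stabilization of oriented type `t`
on the component number `i`, or a destabilization of oriented type `t` on the component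
number `i`. -/
inductive MoveKind
  | exchange
  | stab (t : OType) (i : ℕ)
  | destab (t : OType) (i : ℕ)
deriving DecidableEq

/-- The pair `(R₁, R₂)` is an elementary move realizing the given kind. -/
def KindOk (R₁ R₂ : RectDiagram) : MoveKind → Prop
  | .exchange => IsExchange R₁ R₂
  | .stab t i => IsStabOfOType R₁ R₂ t ∧ ModifiesComp R₁ R₂ i
  | .destab t i => IsDestabOfOType R₁ R₂ t ∧ ModifiesComp R₁ R₂ i

/-- `LChain R s R'` : `s` is a chain of elementary moves from `R` to `R'`, each move
labeled by its kind. -/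
def LChain : RectDiagram → List (MoveKind × RectDiagram) → RectDiagram → Prop
  | R, [], R' => R = R'
  | R, (k, S) :: rest, R' => KindOk R S k ∧ LChain S rest R'


/-- The elementary move `R₁' ↦ R₂'` does the same thing as the elementary move `R₁ ↦ R₂`
(associated with the rectangle `[θ₁;θ₂]×[φ₁;φ₂]`): same removed and added vertices, same
associated rectangle, same signs on the symmetric difference, and the modified component
has the same number. -/
def DoesSameThing (R₁ R₂ R₁' R₂' : RectDiagram) (t1 t2 p1 p2 : Real.Angle) : Prop :=
  IsElemMoveWith R₁' R₂' t1 t2 p1 p2 ∧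
  R₁'.verts \ R₂'.verts = R₁.verts \ R₂.verts ∧
  R₂'.verts \ R₁'.verts = R₂.verts \ R₁.verts ∧
  (∀ v ∈ R₁.verts \ R₂.verts, R₁'.sgn v = R₁.sgn v) ∧
  (∀ v ∈ R₂.verts \ R₁.verts, R₂'.sgn v = R₂.sgn v) ∧
  (∀ i : ℕ, ModifiesComp R₁' R₂' i ↔ ModifiesComp R₁ R₂ i)

/-! ### Arcs of the circle -/

lemma arcLen_nonneg (x y : Real.Angle) : 0 ≤ arcLen x y := by
  unfold arcLen
  have := Real.Angle.neg_pi_lt_toReal (y - x)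
  split_ifs <;> linarith [Real.pi_pos]

lemma arcLen_lt (x y : Real.Angle) : arcLen x y < 2 * π := by
  unfold arcLen
  have := Real.Angle.toReal_le_pi (y - x)
  split_ifs <;> linarith [Real.pi_pos]

lemma coe_arcLen (x y : Real.Angle) : (arcLen x y : Real.Angle) = y - x := by
  unfold arcLen
  split_ifs <;> simp

lemma eq_or_eq_add_of_coe_eq {r s : ℝ} (h : (r : Real.Angle) = s) (hl : -(2 * π) < r - s)
    (hu : r - s < 4 * π) : r = s ∨ r = s + 2 * π := by
  obtain ⟨k, hk⟩ := Real.Angle.angle_eq_iff_two_pi_dvd_sub.1 h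
  have hp := Real.pi_pos
  have h1 : -1 < k := by
    by_contra hc
    have : (k : ℝ) ≤ -1 := by exact_mod_cast not_lt.1 hc
    nlinarith
  have h2 : k < 2 := by
    by_contra hc
    have : (2 : ℝ) ≤ k := by exact_mod_cast not_lt.1 hc
    nlinarith
  obtain rfl | rfl : k = 0 ∨ k = 1 := by omega
  · left; push_cast at hk; linarith
  · right; push_cast at hk; linarith

lemma arcLen_add (x y z : Real.Angle) :
    arcLen x y + arcLen y z = arcLen x z ∨ arcLen x y + arcLen y z = arcLen x z + 2 * π := by
  apply eq_or_eq_add_of_coe_eq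
  · simp [coe_arcLen]
  all_goals
    linarith [arcLen_nonneg x y, arcLen_nonneg y z, arcLen_nonneg x z, arcLen_lt x y,
      arcLen_lt y z, arcLen_lt x z]

lemma arcLen_self (x : Real.Angle) : arcLen x x = 0 := by
  simp [arcLen]

lemma eq_of_arcLen_eq_zero {x y : Real.Angle} (h : arcLen x y = 0) : x = y := by
  have := coe_arcLen x y
  rw [h, Real.Angle.coe_zero] at this
  exact (sub_eq_zero.1 this.symm).symm

lemma arcLen_pos {x y : Real.Angle} (h : x ≠ y) : 0 < arcLen x y :=
  (arcLen_nonneg x y).lt_of_ne fun h' => h (eq_of_arcLen_eq_zero h'.symm)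

lemma arcLen_add_coe (x : Real.Angle) {r : ℝ} (h0 : 0 ≤ r) (h1 : r < 2 * π) :
    arcLen x (x + r) = r := by
  have h : ((arcLen x (x + r) : ℝ) : Real.Angle) = (r : ℝ) := by simp [coe_arcLen]
  have := arcLen_nonneg x (x + r)
  have := arcLen_lt x (x + r)
  rcases eq_or_eq_add_of_coe_eq h (by linarith) (by linarith) with h | h <;> linarith

lemma mem_Arc_iff {x y z : Real.Angle} : z ∈ Arc x y ↔ arcLen x z ≤ arcLen x y := by
  constructor
  · rintro ⟨t, h0, h1, rfl⟩
    rwa [arcLen_add_coe x h0 (h1.trans_lt (arcLen_lt x y))]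
  · intro h
    exact ⟨arcLen x z, arcLen_nonneg x z, h, by simp [coe_arcLen]⟩

/-- The length of the arc running from `x` to `y` in the positive direction if `σ` is `true`,
and in the negative direction otherwise. -/
def dirLen (σ : Bool) (x y : Real.Angle) : ℝ :=
  if σ then arcLen x y else arcLen y x

/-- The closed arc running from `x` to `y` in the positive direction if `σ` is `true`,
and in the negative direction otherwise. -/
def DirArc (σ : Bool) (x y : Real.Angle) : Set Real.Angle :=
  if σ then Arc x y else Arc y x

lemma dirLen_nonneg (σ : Bool) (x y : Real.Angle) : 0 ≤ dirLen σ x y := by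
  cases σ <;> simp [dirLen, arcLen_nonneg]

lemma dirLen_lt (σ : Bool) (x y : Real.Angle) : dirLen σ x y < 2 * π := by
  cases σ <;> simp [dirLen, arcLen_lt]

lemma dirLen_pos (σ : Bool) {x y : Real.Angle} (h : x ≠ y) : 0 < dirLen σ x y := by
  cases σ
  · simpa [dirLen] using arcLen_pos h.symm
  · simpa [dirLen] using arcLen_pos h

lemma dirLen_self (σ : Bool) (x : Real.Angle) : dirLen σ x x = 0 := by
  cases σ <;> simp [dirLen, arcLen_self]

lemma dirLen_add (σ : Bool) (x y z : Real.Angle) :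
    dirLen σ x y + dirLen σ y z = dirLen σ x z ∨
      dirLen σ x y + dirLen σ y z = dirLen σ x z + 2 * π := by
  cases σ
  · simpa [dirLen, add_comm] using arcLen_add z y x
  · simpa [dirLen] using arcLen_add x y z

lemma mem_DirArc_iff {σ : Bool} {x y z : Real.Angle} :
    z ∈ DirArc σ x y ↔ dirLen σ x z ≤ dirLen σ x y := by
  cases σ
  · simp only [DirArc, dirLen, Bool.false_eq_true, if_false, mem_Arc_iff]
    have := arcLen_nonneg y z
    have := arcLen_nonneg z x
    have := arcLen_lt y z
    have := arcLen_lt z x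
    rcases arcLen_add y z x with h | h <;> constructor <;> intro h' <;> linarith
  · simp [DirArc, dirLen, mem_Arc_iff]

lemma dirLen_not (σ : Bool) (x y : Real.Angle) : dirLen (!σ) x y = dirLen σ y x := by
  cases σ <;> simp [dirLen]

lemma left_mem_DirArc (σ : Bool) (x y : Real.Angle) : x ∈ DirArc σ x y := by
  simp [mem_DirArc_iff, dirLen_self, dirLen_nonneg]

lemma right_mem_DirArc (σ : Bool) (x y : Real.Angle) : y ∈ DirArc σ x y := by
  simp [mem_DirArc_iff]

lemma DirArc_subset_left {σ : Bool} {x y z : Real.Angle} (h : z ∈ DirArc σ x y) :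
    DirArc σ x z ⊆ DirArc σ x y := fun _ hw =>
  mem_DirArc_iff.2 ((mem_DirArc_iff.1 hw).trans (mem_DirArc_iff.1 h))

lemma DirArc_subset_right {σ : Bool} {x y z : Real.Angle} (h : z ∈ DirArc σ x y) :
    DirArc σ z y ⊆ DirArc σ x y := by
  intro w hw
  rw [mem_DirArc_iff] at *
  have := dirLen_lt σ x y
  have := dirLen_nonneg σ z y
  have := dirLen_nonneg σ x w
  have := dirLen_nonneg σ x z
  have := dirLen_lt σ z y
  rcases dirLen_add σ x z y with h1 | h1 <;> rcases dirLen_add σ x z w with h2 | h2 <;> linarith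

lemma left_notMem_DirArc_right {σ : Bool} {x y z : Real.Angle} (h : z ∈ DirArc σ x y)
    (hne : z ≠ x) : x ∉ DirArc σ z y := by
  intro hw
  rw [mem_DirArc_iff] at *
  have := dirLen_lt σ x y
  have := dirLen_lt σ z y
  have := dirLen_pos σ hne
  have := dirLen_nonneg σ x z
  have := dirLen_self σ x
  rcases dirLen_add σ x z y with h1 | h1 <;> rcases dirLen_add σ x z x with h2 | h2 <;> linarith

lemma notMem_DirArc_not {σ : Bool} {x y z : Real.Angle} (h : z ∉ DirArc σ x y) (hy : y ≠ x) :
    x ∉ DirArc (!σ) z y := by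
  intro hw
  rw [mem_DirArc_iff] at *
  simp only [dirLen_not] at hw
  have := dirLen_lt σ y z
  have := dirLen_pos σ hy.symm
  have := dirLen_nonneg σ x z
  rcases dirLen_add σ x y z with h1 | h1 <;> linarith

lemma mem_DirArc_of_notMem_Arc {σ : Bool} {x z s t : Real.Angle} (hx : x ∉ Arc s t)
    (hz : z ∈ Arc s t) : s ∈ DirArc σ x z ∨ t ∈ DirArc σ x z := by
  rw [mem_Arc_iff] at hx hz
  have h1 := arcLen_nonneg s z
  have h2 := arcLen_lt s x
  have h3 := arcLen_nonneg x z
  have h4 := arcLen_lt x s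
  have h5 := arcLen_lt z x
  have h6 := arcLen_nonneg t x
  have h7 := arcLen_lt x z
  have h8 := arcLen_nonneg z t
  have h9 := arcLen_nonneg s t
  have h10 := arcLen_nonneg x s
  have h11 := arcLen_lt z t
  have h12 := arcLen_nonneg z x
  have h13 := arcLen_lt t x
  cases σ
  · right
    simp only [mem_DirArc_iff, dirLen, Bool.false_eq_true, if_false]
    rcases arcLen_add s z x with h | h <;> rcases arcLen_add s t x with h' | h' <;> linarith
  · left
    simp only [mem_DirArc_iff, dirLen, if_true]
    rcases arcLen_add x s z with h | h <;> rcases arcLen_add s x z with h' | h' <;>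
      linarith

lemma exists_dirLen_eq (σ : Bool) (x : Real.Angle) {r : ℝ} (h0 : 0 ≤ r) (h1 : r < 2 * π) :
    ∃ z, dirLen σ x z = r := by
  cases σ
  · refine ⟨x - r, ?_⟩
    have := arcLen_add_coe (x - (r : Real.Angle)) h0 h1
    simpa [dirLen] using this
  · exact ⟨x + r, by simpa [dirLen] using arcLen_add_coe x h0 h1⟩

lemma exists_mem_DirArc_small (σ : Bool) {x y : Real.Angle} (h : x ≠ y)
    (F : Finset Real.Angle) :
    ∃ z ∈ DirArc σ x y, z ≠ x ∧ ∀ f ∈ F, f ∈ DirArc σ x z → f = x := by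
  have key : ∃ r : ℝ, 0 < r ∧ r ≤ dirLen σ x y ∧ ∀ f ∈ F, f ≠ x → r < dirLen σ x f := by
    induction F using Finset.induction_on with
    | empty => exact ⟨_, dirLen_pos σ h, le_rfl, by simp⟩
    | insert a F _ ih =>
      obtain ⟨r, h0, h1, h2⟩ := ih
      by_cases hax : a = x
      · exact ⟨r, h0, h1, by simpa [hax] using h2⟩
      have ha := dirLen_pos σ (Ne.symm hax)
      refine ⟨min r (dirLen σ x a / 2), by positivity, (min_le_left _ _).trans h1, ?_⟩
      intro f hf hfx
      rcases Finset.mem_insert.1 hf with rfl | hf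
      · exact (min_le_right _ _).trans_lt (by linarith)
      · exact (min_le_left _ _).trans_lt (h2 f hf hfx)
  obtain ⟨r, h0, h1, h2⟩ := key
  obtain ⟨z, rfl⟩ := exists_dirLen_eq σ x h0.le (h1.trans_lt (dirLen_lt σ x y))
  refine ⟨z, mem_DirArc_iff.2 h1, ?_, fun f hf hfz => ?_⟩
  · rintro rfl
    simp [dirLen_self] at h0
  · by_contra hne
    exact absurd (mem_DirArc_iff.1 hfz) (not_le.2 (h2 f hf hne))

lemma exists_small (σ : Bool) (x : Real.Angle) (F : Finset Real.Angle) :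
    ∃ z, z ≠ x ∧ z ∉ F ∧ ∀ f ∈ F, f ≠ x → z ∈ DirArc σ x f ∧ f ∉ DirArc σ x z := by
  obtain ⟨y, hy⟩ := exists_dirLen_eq σ x Real.pi_pos.le (by linarith [Real.pi_pos])
  have hxy : x ≠ y := by
    rintro rfl
    rw [dirLen_self] at hy
    exact Real.pi_pos.ne hy
  obtain ⟨z, -, hzx, hz⟩ := exists_mem_DirArc_small σ hxy F
  refine ⟨z, hzx, fun h => hzx (hz z h (right_mem_DirArc σ x z)), fun f hf hfx => ?_⟩
  have h : f ∉ DirArc σ x z := fun h => hfx (hz f hf h)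
  refine ⟨?_, h⟩
  rw [mem_DirArc_iff] at *
  exact (not_le.1 h).le

lemma notMem_DirArc_of_notMem_not {σ : Bool} {x y z : Real.Angle} (h : z ∉ DirArc (!σ) x y)
    (hy : y ≠ x) : y ∉ DirArc σ x z := by
  intro hw
  rw [mem_DirArc_iff] at *
  simp only [dirLen_not] at h
  have := dirLen_lt σ x z
  have := dirLen_pos σ hy
  have := dirLen_nonneg σ z x
  have := dirLen_self σ x
  rcases dirLen_add σ x y x with h1 | h1 <;> rcases dirLen_add σ x z x with h2 | h2 <;>
    linarith [dirLen_pos σ hy.symm]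

/-! ### Connectedness and components -/

/-- Every fibre of `f` contains no or exactly two points of `V`, of opposite signs. -/
def LineOK (f : Torus → Real.Angle) (V : Finset Torus) (sgn : Torus → Bool) : Prop :=
  ∀ θ : Real.Angle, (∀ v ∈ V, f v ≠ θ) ∨
    ∃ u w, u ∈ V ∧ w ∈ V ∧ u ≠ w ∧ f u = θ ∧ f w = θ ∧ sgn u ≠ sgn w ∧
      ∀ x ∈ V, f x = θ → x = u ∨ x = w

lemma isDiagSet_iff {V : Finset Torus} {sgn : Torus → Bool} :
    IsDiagSet V sgn ↔ LineOK Prod.fst V sgn ∧ LineOK Prod.snd V sgn := Iff.rfl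

lemma lineOK_iff {f : Torus → Real.Angle} {V : Finset Torus} {sgn : Torus → Bool} :
    LineOK f V sgn ↔ ∀ v ∈ V, ∃ w ∈ V, w ≠ v ∧ f w = f v ∧ sgn w ≠ sgn v ∧
      ∀ x ∈ V, f x = f v → x = v ∨ x = w := by
  constructor
  · intro h v hv
    rcases h (f v) with h | ⟨u, w, hu, hw, huw, hfu, hfw, hs, hx⟩
    · exact absurd rfl (h v hv)
    rcases hx v hv rfl with rfl | rfl
    · exact ⟨w, hw, huw.symm, hfw, hs.symm, hx⟩
    · exact ⟨u, hu, huw, hfu, hs, fun x h1 h2 => (hx x h1 h2).symm⟩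
  · intro h θ
    by_cases hθ : ∀ v ∈ V, f v ≠ θ
    · exact .inl hθ
    push Not at hθ
    obtain ⟨v, hv, rfl⟩ := hθ
    obtain ⟨w, hw, hne, hf, hs, hx⟩ := h v hv
    exact .inr ⟨v, w, hv, hw, hne.symm, rfl, hf, hs.symm, hx⟩

/-- `u` and `v` are points of `V` lying on a common meridian or longitude. -/
def Adj (V : Finset Torus) (u v : Torus) : Prop :=
  u ∈ V ∧ v ∈ V ∧ (u.1 = v.1 ∨ u.2 = v.2)

lemma Adj.symm {V : Finset Torus} {u v : Torus} (h : Adj V u v) : Adj V v u :=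
  ⟨h.2.1, h.1, h.2.2.imp Eq.symm Eq.symm⟩

/-- `v` is reachable from `u` along the edges of `V`. -/
def Conn (V : Finset Torus) : Torus → Torus → Prop := Relation.ReflTransGen (Adj V)

lemma Conn.symm {V : Finset Torus} {u v : Torus} (h : Conn V u v) : Conn V v u := by
  induction h with
  | refl => exact .refl
  | tail _ h ih => exact .head h.symm ih

lemma Adj.conn {V : Finset Torus} {u v : Torus} (h : Adj V u v) : Conn V u v :=
  Relation.ReflTransGen.single h

lemma Conn.mem {V : Finset Torus} {u v : Torus} (h : Conn V u v) (hu : u ∈ V) : v ∈ V := by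
  induction h with
  | refl => exact hu
  | tail _ h _ => exact h.2.1

lemma Conn.lift {V W : Finset Torus} {f : Torus → Torus}
    (hf : ∀ x y, Adj V x y → Conn W (f x) (f y)) {u v : Torus} (h : Conn V u v) :
    Conn W (f u) (f v) := by
  induction h with
  | refl => exact .refl
  | tail _ h ih => exact ih.trans (hf _ _ h)

lemma LineOK.of_closed {f : Torus → Real.Angle} {V S : Finset Torus} {sgn : Torus → Bool}
    (h : LineOK f V sgn) (hS : S ⊆ V) (hc : ∀ u ∈ S, ∀ v ∈ V, f u = f v → v ∈ S) :
    LineOK f S sgn := by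
  rw [lineOK_iff] at *
  intro v hv
  obtain ⟨w, hw, hne, hf, hs, hx⟩ := h v (hS hv)
  exact ⟨w, hc v hv w hw hf.symm, hne, hf, hs, fun x hxS => hx x (hS hxS)⟩

lemma LineOK.closed {f : Torus → Real.Angle} {V S : Finset Torus} {sgn : Torus → Bool}
    (h : LineOK f V sgn) (h' : LineOK f S sgn) (hS : S ⊆ V) :
    ∀ u ∈ S, ∀ v ∈ V, f u = f v → v ∈ S := by
  rw [lineOK_iff] at *
  intro u hu v hv huv
  obtain ⟨w, hw, hne, hf, -, -⟩ := h' u hu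
  obtain ⟨w', -, -, -, -, hx⟩ := h u (hS hu)
  grind

lemma mem_of_conn {V S : Finset Torus} {sgn : Torus → Bool} (hV : IsDiagSet V sgn)
    (hS : IsDiagSet S sgn) (hSV : S ⊆ V) {u v : Torus} (h : Conn V u v) (hu : u ∈ S) : v ∈ S := by
  induction h with
  | refl => exact hu
  | tail _ h ih =>
    rcases h.2.2 with h' | h'
    · exact LineOK.closed hV.1 hS.1 hSV _ ih _ h.2.1 h'
    · exact LineOK.closed hV.2 hS.2 hSV _ ih _ h.2.1 h'

lemma exists_isComponent_iff {V : Finset Torus} {sgn : Torus → Bool} (hV : IsDiagSet V sgn)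
    {u v : Torus} (hu : u ∈ V) :
    (∃ S, IsComponent V sgn S ∧ u ∈ S ∧ v ∈ S) ↔ Conn V u v := by
  classical
  have hK : (V.filter (Conn V u)) ⊆ V := Finset.filter_subset _ _
  have hKu : u ∈ V.filter (Conn V u) := Finset.mem_filter.2 ⟨hu, .refl⟩
  have hKd : IsDiagSet (V.filter (Conn V u)) sgn := by
    refine ⟨LineOK.of_closed hV.1 hK ?_, LineOK.of_closed hV.2 hK ?_⟩ <;>
      · intro a ha b hb hab
        rw [Finset.mem_filter] at *
        exact ⟨hb, ha.2.tail ⟨ha.1, hb, by tauto⟩⟩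
  constructor
  · rintro ⟨S, ⟨hSV, -, hSd, hmin⟩, huS, hvS⟩
    have : V.filter (Conn V u) ⊆ S := fun x hx =>
      mem_of_conn hV hSd hSV (Finset.mem_filter.1 hx).2 huS
    rw [← hmin _ this ⟨u, hKu⟩ hKd] at hvS
    exact (Finset.mem_filter.1 hvS).2
  · intro h
    refine ⟨_, ⟨hK, ⟨u, hKu⟩, hKd, ?_⟩, hKu, Finset.mem_filter.2 ⟨h.mem hu, h⟩⟩
    rintro S hSK ⟨a, ha⟩ hS
    refine hSK.antisymm fun x hx => mem_of_conn hV hS (hSK.trans hK) ?_ ha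
    exact (Conn.symm (Finset.mem_filter.1 (hSK ha)).2).trans (Finset.mem_filter.1 hx).2

namespace RectDiagram

/-- A diagram built from a numbering of the vertices that separates exactly the classes of
vertices connected by edges. -/
def ofConn (V : Finset Torus) (sgn : Torus → Bool) (comp : Torus → ℕ) (hd : IsDiagSet V sgn)
    (hc : ∀ u ∈ V, ∀ v ∈ V, (comp u = comp v ↔ Conn V u v)) : RectDiagram :=
  ⟨V, sgn, comp, hd, fun u hu v hv => by rw [hc u hu v hv, exists_isComponent_iff hd hu]⟩

variable (R : RectDiagram)

lemma comp_eq_iff_conn {u v : Torus} (hu : u ∈ R.verts) (hv : v ∈ R.verts) :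
    R.comp u = R.comp v ↔ Conn R.verts u v := by
  rw [R.comp_eq_iff u hu v hv, exists_isComponent_iff R.diag hu]

lemma comp_eq_of_adj {u v : Torus} (hu : u ∈ R.verts) (hv : v ∈ R.verts)
    (h : u.1 = v.1 ∨ u.2 = v.2) : R.comp u = R.comp v :=
  (R.comp_eq_iff_conn hu hv).2 (Adj.conn ⟨hu, hv, h⟩)

lemma exists_vert {v : Torus} (hv : v ∈ R.verts) :
    ∃ w ∈ R.verts, w ≠ v ∧ w.1 = v.1 ∧ R.sgn w ≠ R.sgn v ∧
      ∀ x ∈ R.verts, x.1 = v.1 → x = v ∨ x = w :=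
  lineOK_iff.1 (isDiagSet_iff.1 R.diag).1 v hv

lemma exists_horiz {v : Torus} (hv : v ∈ R.verts) :
    ∃ w ∈ R.verts, w ≠ v ∧ w.2 = v.2 ∧ R.sgn w ≠ R.sgn v ∧
      ∀ x ∈ R.verts, x.2 = v.2 → x = v ∨ x = w :=
  lineOK_iff.1 (isDiagSet_iff.1 R.diag).2 v hv

/-- The image of a diagram under a bijection of the torus preserving the coordinate lines. -/
def transport (e : Torus ≃ Torus)
    (hd : IsDiagSet (R.verts.map e.toEmbedding) (R.sgn ∘ e.symm))
    (ha : ∀ x y, ((e x).1 = (e y).1 ∨ (e x).2 = (e y).2) ↔ (x.1 = y.1 ∨ x.2 = y.2)) :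
    RectDiagram :=
  ofConn (R.verts.map e.toEmbedding) (R.sgn ∘ e.symm) (R.comp ∘ e.symm) hd <| by
    have hadj : ∀ x y, Adj R.verts x y ↔ Adj (R.verts.map e.toEmbedding) (e x) (e y) := by
      intro x y
      simp [Adj, ha]
    intro u hu v hv
    obtain ⟨u, hu', rfl⟩ := Finset.mem_map.1 hu
    obtain ⟨v, hv', rfl⟩ := Finset.mem_map.1 hv
    simp only [Equiv.coe_toEmbedding, Function.comp_apply, Equiv.symm_apply_apply]
    rw [R.comp_eq_iff_conn hu' hv']
    constructor
    · exact Conn.lift fun x y h => ((hadj x y).1 h).conn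
    · intro h
      simpa using Conn.lift (W := R.verts) (f := e.symm)
        (fun x y h => ((hadj _ _).2 (by simpa using h)).conn) h

lemma _root_.RectDiag.LineOK.map {f g : Torus → Real.Angle} {V : Finset Torus}
    {sgn : Torus → Bool} (h : LineOK f V sgn) (e : Torus ≃ Torus)
    (he : ∀ x y, g (e x) = g (e y) ↔ f x = f y) :
    LineOK g (V.map e.toEmbedding) (sgn ∘ e.symm) := by
  rw [lineOK_iff] at *
  intro v hv
  obtain ⟨v, hv', rfl⟩ := Finset.mem_map.1 hv
  obtain ⟨w, hw, hne, hf, hs, hx⟩ := h v hv'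
  refine ⟨e w, by simpa, by simpa, by simpa [he], by simpa, fun x hxV => ?_⟩
  obtain ⟨x, hx₀, rfl⟩ := Finset.mem_map.1 hxV
  simpa [he] using hx x hx₀

/-- The diagram obtained by exchanging the two coordinates. -/
def transpose : RectDiagram :=
  R.transport (Equiv.prodComm _ _)
    ⟨LineOK.map R.diag.2 _ fun _ _ => Iff.rfl, LineOK.map R.diag.1 _ fun _ _ => Iff.rfl⟩
    fun _ _ => or_comm

@[simp] lemma mem_transpose {x : Torus} : x ∈ R.transpose.verts ↔ x.swap ∈ R.verts := by
  simp [transpose, transport, ofConn, Prod.swap]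

@[simp] lemma transpose_sgn (x : Torus) : R.transpose.sgn x = R.sgn x.swap := rfl

@[simp] lemma transpose_comp (x : Torus) : R.transpose.comp x = R.comp x.swap := rfl

lemma card_transpose : R.transpose.verts.card = R.verts.card :=
  Finset.card_map _

lemma ext_of {R S : RectDiagram} (hv : R.verts = S.verts) (hs : R.sgn = S.sgn)
    (hc : R.comp = S.comp) : R = S := by
  cases R; cases S; simp_all

lemma transpose_transpose : R.transpose.transpose = R :=
  ext_of (by ext; simp) rfl rfl

/-- The diagram obtained by renaming the longitudes. -/
def rename (e : Real.Angle ≃ Real.Angle) : RectDiagram :=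
  R.transport (Equiv.prodCongr (Equiv.refl _) e)
    ⟨LineOK.map R.diag.1 _ (by simp), LineOK.map R.diag.2 _ (by simp)⟩
    (by simp)

lemma mem_rename {e : Real.Angle ≃ Real.Angle} {x : Torus} :
    x ∈ (R.rename e).verts ↔ (x.1, e.symm x.2) ∈ R.verts := by
  simp only [rename, transport, ofConn, Finset.mem_map_equiv]
  rfl

lemma rename_sgn (e : Real.Angle ≃ Real.Angle) (x : Torus) :
    (R.rename e).sgn x = R.sgn (x.1, e.symm x.2) := rfl

lemma rename_comp (e : Real.Angle ≃ Real.Angle) (x : Torus) :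
    (R.rename e).comp x = R.comp (x.1, e.symm x.2) := rfl

end RectDiagram

/-! ### Stabilizations at a vertex -/

/-- `X` is obtained from `R` by a stabilization at the vertex `v`, adding the meridian `g` and
the longitude `b`. The associated rectangle extends from `v` in the directions `σ`, `τ`. -/
structure StabAt (R X : RectDiagram) (v : Torus) (σ τ : Bool) (g b : Real.Angle) : Prop where
  mem : v ∈ R.verts
  fresh_fst : ∀ z ∈ R.verts, z.1 ≠ g
  fresh_snd : ∀ z ∈ R.verts, z.2 ≠ b
  empty : ∀ z ∈ R.verts, z.1 ∈ DirArc σ v.1 g → z.2 ∈ DirArc τ v.2 b → z = v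
  mem_iff : ∀ z, z ∈ X.verts ↔
    (z ∈ R.verts ∧ z ≠ v) ∨ z = (g, v.2) ∨ z = (v.1, b) ∨ z = (g, b)
  old : ∀ z ∈ R.verts, z ≠ v → X.sgn z = R.sgn z ∧ X.comp z = R.comp z
  horiz : X.sgn (g, v.2) = R.sgn v ∧ X.comp (g, v.2) = R.comp v
  vert : X.sgn (v.1, b) = R.sgn v ∧ X.comp (v.1, b) = R.comp v
  diag : X.sgn (g, b) = !R.sgn v ∧ X.comp (g, b) = R.comp v

lemma StabAt.of_mem_iff {R X : RectDiagram} {v : Torus} {σ τ : Bool} {g b : Real.Angle}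
    (hv : v ∈ R.verts) (hg : v.1 ≠ g) (hb : v.2 ≠ b) (hgv : (g, v.2) ∉ R.verts)
    (hvb : (v.1, b) ∉ R.verts) (hgb : (g, b) ∉ R.verts)
    (empty : ∀ z ∈ R.verts, z.1 ∈ DirArc σ v.1 g → z.2 ∈ DirArc τ v.2 b → z = v)
    (mem_iff : ∀ z, z ∈ X.verts ↔
      (z ∈ R.verts ∧ z ≠ v) ∨ z = (g, v.2) ∨ z = (v.1, b) ∨ z = (g, b))
    (old : ∀ z ∈ R.verts, z ≠ v → X.sgn z = R.sgn z ∧ X.comp z = R.comp z) :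
    StabAt R X v σ τ g b := by
  have m1 : (g, v.2) ∈ X.verts := by simp [mem_iff]
  have m2 : (v.1, b) ∈ X.verts := by simp [mem_iff]
  have m3 : (g, b) ∈ X.verts := by simp [mem_iff]
  have hf1 : ∀ z ∈ R.verts, z.1 ≠ g := by
    intro z hz hzg
    have hzX : z ∈ X.verts := (mem_iff z).2 (.inl ⟨hz, by rintro rfl; exact hg hzg⟩)
    obtain ⟨w, -, -, -, -, h⟩ := X.exists_vert hzX
    have h1 := h _ m1 hzg.symm
    have h2 := h _ m3 hzg.symm
    have : ((g, v.2) : Torus) ≠ (g, b) := by simpa using hb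
    grind
  have hf2 : ∀ z ∈ R.verts, z.2 ≠ b := by
    intro z hz hzb
    have hzX : z ∈ X.verts := (mem_iff z).2 (.inl ⟨hz, by rintro rfl; exact hb hzb⟩)
    obtain ⟨w, -, -, -, -, h⟩ := X.exists_horiz hzX
    have h1 := h _ m2 hzb.symm
    have h2 := h _ m3 hzb.symm
    have : ((v.1, b) : Torus) ≠ (g, b) := by simpa using hg
    grind
  obtain ⟨w, hw, hwv, hw1, hws, -⟩ := R.exists_vert hv
  have hwX : w ∈ X.verts := (mem_iff w).2 (.inl ⟨hw, hwv⟩)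
  obtain ⟨u, hu, huv, hu2, hus, -⟩ := R.exists_horiz hv
  have huX : u ∈ X.verts := (mem_iff u).2 (.inl ⟨hu, huv⟩)
  have hsh : X.sgn (g, v.2) = R.sgn v := by
    obtain ⟨y, -, -, -, hs, h⟩ := X.exists_horiz huX
    have hy := (h _ m1 hu2.symm).resolve_left fun h => hf1 u hu (by rw [← h])
    rw [← hy, (old u hu huv).1] at hs
    exact (Bool.eq_not.2 hs).trans (Bool.eq_not.2 hus.symm).symm
  have hsv : X.sgn (v.1, b) = R.sgn v := by
    obtain ⟨y, -, -, -, hs, h⟩ := X.exists_vert hwX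
    have hy := (h _ m2 hw1.symm).resolve_left fun h => hf2 w hw (by rw [← h])
    rw [← hy, (old w hw hwv).1] at hs
    exact (Bool.eq_not.2 hs).trans (Bool.eq_not.2 hws.symm).symm
  have hch : X.comp (g, v.2) = R.comp v := by
    rw [X.comp_eq_of_adj m1 huX (.inr hu2.symm), (old u hu huv).2,
      R.comp_eq_of_adj hu hv (.inr hu2)]
  have hcv : X.comp (v.1, b) = R.comp v := by
    rw [X.comp_eq_of_adj m2 hwX (.inl hw1.symm), (old w hw hwv).2,
      R.comp_eq_of_adj hw hv (.inl hw1)]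
  refine ⟨hv, hf1, hf2, empty, mem_iff, old, ⟨hsh, hch⟩, ⟨hsv, hcv⟩, ?_, ?_⟩
  · obtain ⟨y, -, -, -, hs, h⟩ := X.exists_vert m1
    have := h _ m3 rfl
    have : ((g, v.2) : Torus) ≠ (g, b) := by simpa using hb
    grind
  · rw [X.comp_eq_of_adj m3 m1 (.inl rfl), hch]

lemma exists_stabAt {R : RectDiagram} {v : Torus} {σ τ : Bool} {g b : Real.Angle}
    (hv : v ∈ R.verts) (hg : ∀ z ∈ R.verts, z.1 ≠ g) (hb : ∀ z ∈ R.verts, z.2 ≠ b)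
    (empty : ∀ z ∈ R.verts, z.1 ∈ DirArc σ v.1 g → z.2 ∈ DirArc τ v.2 b → z = v) :
    ∃ X, StabAt R X v σ τ g b := by
  classical
  set V : Finset Torus := insert (g, v.2) (insert (v.1, b) (insert (g, b) (R.verts.erase v)))
    with hVdef
  have hV : ∀ z, z ∈ V ↔ (z ∈ R.verts ∧ z ≠ v) ∨ z = (g, v.2) ∨ z = (v.1, b) ∨ z = (g, b) := by
    intro z
    simp only [hVdef, Finset.mem_insert, Finset.mem_erase]
    tauto
  clear_value V
  have hgv := hg v hv
  have hbv := hb v hv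
  have n1 : (g, v.2) ∉ R.verts := fun h => hg _ h rfl
  have n2 : (v.1, b) ∉ R.verts := fun h => hb _ h rfl
  have n3 : (g, b) ∉ R.verts := fun h => hg _ h rfl
  let f : Torus → Torus := fun x => if x ∈ R.verts then x else v
  let sgn : Torus → Bool := fun x => if x = (g, b) then !R.sgn v else R.sgn (f x)
  have hd : IsDiagSet V sgn := by
    rw [isDiagSet_iff, lineOK_iff, lineOK_iff]
    constructor
    · intro x hx
      by_cases hxg : x.1 = g
      · by_cases hxb : x.2 = b
        · refine ⟨(g, v.2), by simp [hV], ?_, hxg.symm, ?_, ?_⟩ <;> grind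
        · refine ⟨(g, b), by simp [hV], ?_, hxg.symm, ?_, ?_⟩ <;> grind
      · by_cases hxv : x = (v.1, b)
        · obtain ⟨w, hw, hwv, hw1, hws, hw2⟩ := R.exists_vert hv
          refine ⟨w, ?_, ?_, ?_, ?_, ?_⟩ <;> grind
        · have hxR : x ∈ R.verts ∧ x ≠ v := by grind
          obtain ⟨w, hw, hwv, hw1, hws, hw2⟩ := R.exists_vert hxR.1
          by_cases hwv : w = v
          · refine ⟨(v.1, b), ?_, ?_, ?_, ?_, ?_⟩ <;> grind
          · refine ⟨w, ?_, ?_, ?_, ?_, ?_⟩ <;> grind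
    · intro x hx
      by_cases hxb : x.2 = b
      · by_cases hxg : x.1 = g
        · refine ⟨(v.1, b), by simp [hV], ?_, hxb.symm, ?_, ?_⟩ <;> grind
        · refine ⟨(g, b), by simp [hV], ?_, hxb.symm, ?_, ?_⟩ <;> grind
      · by_cases hxv : x = (g, v.2)
        · obtain ⟨w, hw, hwv, hw1, hws, hw2⟩ := R.exists_horiz hv
          refine ⟨w, ?_, ?_, ?_, ?_, ?_⟩ <;> grind
        · have hxR : x ∈ R.verts ∧ x ≠ v := by grind
          obtain ⟨w, hw, hwv, hw1, hws, hw2⟩ := R.exists_horiz hxR.1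
          by_cases hwv : w = v
          · refine ⟨(g, v.2), ?_, ?_, ?_, ?_, ?_⟩ <;> grind
          · refine ⟨w, ?_, ?_, ?_, ?_, ?_⟩ <;> grind
  have hfR : ∀ x, f x ∈ R.verts := by grind
  have hcorner : Conn V (v.1, b) (g, v.2) :=
    (Adj.conn ⟨by simp [hV], by simp [hV], .inr rfl⟩ : Conn V (v.1, b) (g, b)).trans
      (Adj.conn ⟨by simp [hV], by simp [hV], .inl rfl⟩)
  let s : Torus → Torus := fun x => if x = v then (v.1, b) else x
  have hs : ∀ x ∈ V, Conn V x (s (f x)) := by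
    intro x hx
    rcases (hV x).1 hx with h | rfl | rfl | rfl
    · simp [s, f, h, Conn, Relation.ReflTransGen.refl]
    · simpa [s, f, n1] using hcorner.symm
    · simp [s, f, n2, Conn, Relation.ReflTransGen.refl]
    · simpa [s, f, n3] using
        (Adj.conn ⟨by simp [hV], by simp [hV], .inr rfl⟩ : Conn V (g, b) (v.1, b))
  have hsa : ∀ x y, Adj R.verts x y → Conn V (s x) (s y) := by
    have aux : ∀ y, Adj R.verts v y → y ≠ v → Conn V (v.1, b) y := by
      rintro y ⟨-, hy, h⟩ hyv
      have hyV : y ∈ V := (hV y).2 (.inl ⟨hy, hyv⟩)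
      rcases h with h | h
      · exact Adj.conn ⟨by simp [hV], hyV, .inl h⟩
      · exact hcorner.trans (Adj.conn ⟨by simp [hV], hyV, .inr h⟩)
    intro x y h
    by_cases hx : x = v <;> by_cases hy : y = v
    · simp [s, hx, hy, Conn, Relation.ReflTransGen.refl]
    · simpa [s, hx, hy] using aux y (hx ▸ h) hy
    · simpa [s, hx, hy] using (aux x (hy ▸ h).symm hx).symm
    · simpa [s, hx, hy] using
        Adj.conn (V := V) ⟨(hV x).2 (.inl ⟨h.1, hx⟩), (hV y).2 (.inl ⟨h.2.1, hy⟩), h.2.2⟩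
  have hfa : ∀ x y, Adj V x y → Conn R.verts (f x) (f y) := by
    rintro x y ⟨hx, hy, hxy⟩
    by_cases h : f x = f y
    · rw [h]
      exact .refl
    · refine Adj.conn ⟨hfR x, hfR y, ?_⟩
      grind
  have hc : ∀ x ∈ V, ∀ y ∈ V, (R.comp (f x) = R.comp (f y) ↔ Conn V x y) := by
    intro x hx y hy
    rw [R.comp_eq_iff_conn (hfR x) (hfR y)]
    exact ⟨fun h => (hs x hx).trans ((Conn.lift hsa h).trans (hs y hy).symm), Conn.lift hfa⟩
  exact ⟨RectDiagram.ofConn V sgn (R.comp ∘ f) hd hc,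
    .of_mem_iff hv hgv hbv n1 n2 n3 empty hV fun z hz _ => by
      have : z ≠ (g, b) := by grind
      simp [RectDiagram.ofConn, sgn, f, hz, this]⟩

lemma StabAt.transpose {R X : RectDiagram} {v : Torus} {σ τ : Bool} {g b : Real.Angle}
    (h : StabAt R X v σ τ g b) : StabAt R.transpose X.transpose v.swap τ σ b g where
  mem := by simpa using h.mem
  fresh_fst z hz := h.fresh_snd z.swap (by simpa using hz)
  fresh_snd z hz := h.fresh_fst z.swap (by simpa using hz)
  empty z hz h1 h2 := by
    rw [← h.empty z.swap (by simpa using hz) h2 h1, Prod.swap_swap]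
  mem_iff z := by
    obtain ⟨x, y⟩ := z
    obtain ⟨v1, v2⟩ := v
    simp only [RectDiagram.mem_transpose, h.mem_iff, Prod.swap, Prod.mk.injEq, ne_eq]
    tauto
  old z hz hzv := h.old z.swap (by simpa using hz) fun h' => hzv (by rw [← h', Prod.swap_swap])
  horiz := h.vert
  vert := h.horiz
  diag := h.diag

/-- The oriented type of a stabilization at a vertex of sign `s` whose rectangle extends from
the vertex in the directions `σ`, `τ`. -/
def oType (σ τ s : Bool) : OType :=
  match σ == τ, σ == s with
  | true, false => .posI
  | true, true => .negI
  | false, false => .posII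
  | false, true => .negII

lemma oType_not (σ τ s : Bool) : oType (!σ) (!τ) (!s) = oType σ τ s := by
  revert σ τ s; decide

lemma oType_injective {σ τ σ' τ' s : Bool} (h : oType σ τ s = oType σ' τ' s) :
    σ = σ' ∧ τ = τ' := by
  revert σ τ σ' τ' s; decide

lemma exists_oType_eq (t : OType) (s : Bool) : ∃ σ τ, oType σ τ s = t := by
  revert s; cases t <;> decide

/-! ### Exchange moves -/

lemma IsExchange.symm {X X' : RectDiagram} (h : IsExchange X X') : IsExchange X' X := by
  obtain ⟨⟨t1, t2, p1, p2, ht, hp, hd, ⟨u, v, hu, hv, he⟩, h1, h2, hr, ho⟩, hc⟩ := h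
  refine ⟨⟨t1, t2, p1, p2, ht, hp, by rwa [symmDiff_comm], ⟨u, v, ?_, ?_, he.symm⟩, h2, h1,
    by rwa [Set.union_comm], fun z hz => ?_⟩, hc.symm⟩
  · rwa [symmDiff_comm]
  · rwa [symmDiff_comm]
  · rw [Finset.inter_comm] at hz
    exact ⟨(ho z hz).1.symm, (ho z hz).2.symm⟩

lemma exists_arc_eq (σ : Bool) (x y : Real.Angle) :
    ∃ s t, (s = x ∧ t = y ∨ s = y ∧ t = x) ∧ DirArc σ x y = Arc s t := by
  cases σ
  · exact ⟨y, x, .inr ⟨rfl, rfl⟩, rfl⟩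
  · exact ⟨x, y, .inl ⟨rfl, rfl⟩, rfl⟩

lemma mem_corners_iff {t1 t2 p1 p2 x y b β : Real.Angle} {z : Torus}
    (ht : t1 = x ∧ t2 = y ∨ t1 = y ∧ t2 = x) (hp : p1 = b ∧ p2 = β ∨ p1 = β ∧ p2 = b) :
    z ∈ corners t1 t2 p1 p2 ↔ z = (x, b) ∨ z = (y, b) ∨ z = (x, β) ∨ z = (y, β) := by
  simp only [corners, Finset.mem_insert, Finset.mem_singleton]
  rcases ht with ⟨rfl, rfl⟩ | ⟨rfl, rfl⟩ <;> rcases hp with ⟨rfl, rfl⟩ | ⟨rfl, rfl⟩ <;> tauto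

lemma isExchange_of_horiz {X X' : RectDiagram} {x y b β : Real.Angle} (σ τ : Bool)
    (hxy : x ≠ y) (hb : b ≠ β) (h1 : (x, b) ∈ X.verts) (h2 : (y, b) ∈ X.verts)
    (n1 : (x, β) ∉ X.verts) (n2 : (y, β) ∉ X.verts)
    (hm : ∀ z, z ∈ X'.verts ↔
      (z ∈ X.verts ∧ z ≠ (x, b) ∧ z ≠ (y, b)) ∨ z = (x, β) ∨ z = (y, β))
    (he : ∀ z ∈ X.verts, z.1 ∈ DirArc σ x y → z.2 ∈ DirArc τ b β → z = (x, b) ∨ z = (y, b))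
    (hs : ∀ z ∈ X.verts, z ∈ X'.verts → X.sgn z = X'.sgn z ∧ X.comp z = X'.comp z) :
    IsExchange X X' := by
  obtain ⟨t1, t2, ht, hta⟩ := exists_arc_eq σ x y
  obtain ⟨p1, p2, hp, hpa⟩ := exists_arc_eq τ b β
  have mx := left_mem_DirArc σ x y
  have my := right_mem_DirArc σ x y
  have mb := left_mem_DirArc τ b β
  have mβ := right_mem_DirArc τ b β
  rw [hta] at he mx my
  rw [hpa] at he mb mβ
  have hcor : ∀ z, z ∈ corners t1 t2 p1 p2 ↔
      z = (x, b) ∨ z = (y, b) ∨ z = (x, β) ∨ z = (y, β) := fun z => mem_corners_iff ht hp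
  have hne : ∀ z w : Real.Angle, (z, b) ≠ (w, β) := by simp [hb]
  have hsd : ∀ z, z ∈ symmDiff X.verts X'.verts ↔
      z = (x, b) ∨ z = (y, b) ∨ z = (x, β) ∨ z = (y, β) := by
    intro z
    rw [Finset.mem_symmDiff, hm]
    grind
  refine ⟨⟨t1, t2, p1, p2, by grind, by grind, ?_, ⟨(x, b), (y, b), by simp [hsd], by simp [hsd],
    .inl ⟨h1, h2, by simpa using hxy, .inr rfl⟩⟩, ?_, ?_, ?_, ?_⟩, ?_⟩
  · ext z
    rw [hsd, hcor]
  · intro h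
    have := (hm _).1 (h h1)
    grind
  · intro h
    exact n1 (h ((hm _).2 (.inr (.inl rfl))))
  · ext z
    simp only [Set.mem_inter_iff, RectSet, Set.mem_ofPred_eq, Set.mem_union, Finset.mem_coe, hcor,
      hm]
    constructor
    · rintro ⟨⟨ha, hb⟩, h | h⟩
      · have := he z h ha hb
        tauto
      · have := he z
        tauto
    · rintro (rfl | rfl | rfl | rfl) <;> simp [*]
  · intro z hz
    rw [Finset.mem_inter] at hz
    exact hs z hz.1 hz.2
  · have : X'.verts =
        insert (x, β) (insert (y, β) ((X.verts.erase (x, b)).erase (y, b))) := by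
      ext z
      simp only [hm, Finset.mem_insert, Finset.mem_erase]
      tauto
    have hx : ((y, b) : Torus) ≠ (x, b) := by simpa using hxy.symm
    have hx' : ((x, β) : Torus) ≠ (y, β) := by simpa using hxy
    rw [this, Finset.card_insert_of_notMem (by simp [n1, hx']),
      Finset.card_insert_of_notMem (by simp [n2]),
      Finset.card_erase_of_mem (by simp [h2, hx]), Finset.card_erase_of_mem h1]
    have : 1 < X.verts.card := Finset.one_lt_card.2 ⟨_, h1, _, h2, hx.symm⟩
    omega

lemma mem_corners_swap {t1 t2 p1 p2 : Real.Angle} {z : Torus} :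
    z.swap ∈ corners t1 t2 p1 p2 ↔ z ∈ corners p1 p2 t1 t2 := by
  obtain ⟨x, y⟩ := z
  simp only [corners, Finset.mem_insert, Finset.mem_singleton, Prod.swap, Prod.mk.injEq]
  tauto

lemma IsExchange.transpose {X X' : RectDiagram} (h : IsExchange X X') :
    IsExchange X.transpose X'.transpose := by
  obtain ⟨⟨t1, t2, p1, p2, ht, hp, hd, ⟨u, v, hu, hv, he⟩, h1, h2, hr, ho⟩, hc⟩ := h
  refine ⟨⟨p1, p2, t1, t2, hp, ht, ?_, ⟨u.swap, v.swap, ?_, ?_, ?_⟩, ?_, ?_, ?_, ?_⟩, ?_⟩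
  · ext z
    rw [Finset.ext_iff] at hd
    simpa [Finset.mem_symmDiff, mem_corners_swap] using hd z.swap
  · simpa [Finset.mem_symmDiff] using hu
  · simpa [Finset.mem_symmDiff] using hv
  · simpa [IsEdge, or_comm] using he
  · exact fun h => h1 fun z hz => by simpa using @h z.swap (by simpa using hz)
  · exact fun h => h2 fun z hz => by simpa using @h z.swap (by simpa using hz)
  · ext z
    rw [Set.ext_iff] at hr
    simpa [RectSet, mem_corners_swap, and_comm] using hr z.swap
  · exact fun z hz => ho z.swap (by simpa using hz)
  · simpa [RectDiagram.card_transpose] using hc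

/-- `X` and `X'` are related by a sequence of exchange moves. -/
abbrev ExchEquiv : RectDiagram → RectDiagram → Prop := Relation.ReflTransGen IsExchange

lemma ExchEquiv.symm {X X' : RectDiagram} (h : ExchEquiv X X') : ExchEquiv X' X := by
  induction h with
  | refl => exact .refl
  | tail _ h ih => exact .head h.symm ih

lemma ExchEquiv.transpose {X X' : RectDiagram} (h : ExchEquiv X X') :
    ExchEquiv X.transpose X'.transpose := by
  induction h with
  | refl => exact .refl
  | tail _ h ih => exact .tail ih h.transpose

lemma ExchEquiv.of_transpose {X X' : RectDiagram} (h : ExchEquiv X.transpose X'.transpose) :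
    ExchEquiv X X' := by
  simpa only [RectDiagram.transpose_transpose] using h.transpose

/-! ### Independence of the stabilization of its position -/

lemma StabAt.isExchange_of_longitude {R X X' : RectDiagram} {v : Torus} {σ τ : Bool}
    {g b b' : Real.Angle} (h : StabAt R X v σ τ g b) (h' : StabAt R X' v σ τ g b')
    (hb : b' ∈ DirArc τ v.2 b) (hne : b' ≠ b) : IsExchange X X' := by
  have f1 := h.fresh_fst
  have f2 := h.fresh_snd
  have f2' := h'.fresh_snd
  have hv := h.mem
  have o := h.old
  have o' := h'.old
  obtain ⟨s1, c1⟩ := h.horiz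
  obtain ⟨s1', c1'⟩ := h'.horiz
  have hA : v.2 ∉ DirArc (!τ) b b' := by
    have := left_notMem_DirArc_right hb (f2' v hv).symm
    cases τ <;> exact this
  have hsub : DirArc (!τ) b b' ⊆ DirArc τ v.2 b := by
    have := DirArc_subset_right hb
    cases τ <;> exact this
  refine isExchange_of_horiz (x := v.1) (y := g) σ (!τ) (f1 v hv) hne.symm ?_ ?_ ?_ ?_ ?_ ?_ ?_
  · simp [h.mem_iff]
  · simp [h.mem_iff]
  · rw [h.mem_iff]; grind
  · rw [h.mem_iff]; grind
  · intro z
    rw [h.mem_iff, h'.mem_iff]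
    grind
  · intro z hz hz1 hz2
    rw [h.mem_iff] at hz
    rcases hz with ⟨hz, hzv⟩ | rfl | hz | hz
    · exact absurd (h.empty z hz hz1 (hsub hz2)) hzv
    · exact absurd hz2 hA
    · exact .inl hz
    · exact .inr hz
  · intro z hz hz'
    rw [h.mem_iff] at hz
    rw [h'.mem_iff] at hz'
    grind

lemma StabAt.exchEquiv_of_mem {R X X' : RectDiagram} {v : Torus} {σ τ : Bool}
    {g g' b b' : Real.Angle} (h : StabAt R X v σ τ g b) (h' : StabAt R X' v σ τ g' b')
    (hg : g' ∈ DirArc σ v.1 g) (hgne : g' ≠ g) (hb : b' ∈ DirArc τ v.2 b) (hbne : b' ≠ b) :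
    ExchEquiv X X' := by
  obtain ⟨Y, hY⟩ : ∃ Y, StabAt R Y v σ τ g' b :=
    exists_stabAt h.mem h'.fresh_fst h.fresh_snd fun z hz h1 h2 =>
      h.empty z hz (DirArc_subset_left hg h1) h2
  refine .trans (ExchEquiv.of_transpose (.single ?_))
    (.single (hY.isExchange_of_longitude h' hb hbne))
  exact h.transpose.isExchange_of_longitude hY.transpose hg hgne

/-- The result of a stabilization at `v` in given directions does not depend, up to exchange
moves, on the meridian and longitude added. -/
lemma StabAt.exchEquiv {R X X' : RectDiagram} {v : Torus} {σ τ : Bool} {g g' b b' : Real.Angle}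
    (h : StabAt R X v σ τ g b) (h' : StabAt R X' v σ τ g' b') : ExchEquiv X X' := by
  classical
  obtain ⟨g₀, -, hg₀, hg⟩ :=
    exists_small σ v.1 (insert g (insert g' (R.verts.image Prod.fst)))
  obtain ⟨b₀, -, hb₀, hb⟩ :=
    exists_small τ v.2 (insert b (insert b' (R.verts.image Prod.snd)))
  simp only [Finset.mem_insert, Finset.mem_image, not_or, not_exists, not_and] at hg₀ hb₀
  have m1 := (hg g (by simp) (h.fresh_fst v h.mem).symm).1
  have m2 := (hg g' (by simp) (h'.fresh_fst v h.mem).symm).1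
  have m3 := (hb b (by simp) (h.fresh_snd v h.mem).symm).1
  have m4 := (hb b' (by simp) (h'.fresh_snd v h.mem).symm).1
  obtain ⟨Y, hY⟩ : ∃ Y, StabAt R Y v σ τ g₀ b₀ :=
    exists_stabAt h.mem hg₀.2.2 hb₀.2.2 fun z hz h1 h2 =>
      h.empty z hz (DirArc_subset_left m1 h1) (DirArc_subset_left m3 h2)
  exact .trans (h.exchEquiv_of_mem hY m1 hg₀.1 m3 hb₀.1)
    (h'.exchEquiv_of_mem hY m2 hg₀.2.1 m4 hb₀.2.1).symm

lemma isExchange_rename {X : RectDiagram} {x y b β : Real.Angle} (τ : Bool)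
    (hxy : x ≠ y) (h1 : (x, b) ∈ X.verts) (h2 : (y, b) ∈ X.verts)
    (hβ : ∀ z ∈ X.verts, z.2 ≠ β)
    (he : ∀ z ∈ X.verts, z.2 ∈ DirArc τ b β → z.2 = b) :
    IsExchange X (X.rename (Equiv.swap b β)) := by
  have hbβ : b ≠ β := hβ _ h1
  have hlev : ∀ z ∈ X.verts, z.2 = b → z = (x, b) ∨ z = (y, b) := by
    obtain ⟨w, -, -, -, -, hw⟩ := X.exists_horiz h1
    have h3 := (hw _ h2 rfl).resolve_left (by simpa using hxy.symm)
    rwa [← h3] at hw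
  have hfix : ∀ z ∈ X.verts, z.2 ≠ b → (z.1, Equiv.swap b β z.2) = z := by
    intro z hz hzb
    rw [Equiv.swap_apply_of_ne_of_ne hzb (hβ z hz)]
  refine isExchange_of_horiz true τ hxy hbβ h1 h2 (fun h => hβ _ h rfl) (fun h => hβ _ h rfl) ?_
    (fun z hz _ h => hlev z hz (he z hz h)) ?_
  · intro z
    rw [RectDiagram.mem_rename, Equiv.symm_swap]
    rcases eq_or_ne z.2 b with hz | hz
    · rw [hz, Equiv.swap_apply_left]
      have := hβ (z.1, β)
      have := hlev z
      grind
    · rcases eq_or_ne z.2 β with hz' | hz'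
      · rw [hz', Equiv.swap_apply_right]
        have := hlev (z.1, b)
        have := hβ z
        grind
      · rw [Equiv.swap_apply_of_ne_of_ne hz hz']
        grind
  · intro z hz hz'
    rw [RectDiagram.mem_rename, Equiv.symm_swap] at hz'
    have hzb : z.2 ≠ b := by
      intro h
      rw [h, Equiv.swap_apply_left] at hz'
      exact hβ _ hz' rfl
    rw [RectDiagram.rename_sgn, RectDiagram.rename_comp, Equiv.symm_swap, hfix z hz hzb]
    exact ⟨rfl, rfl⟩

/-- A stabilization can be moved along a horizontal edge, reversing both directions. -/
lemma exists_slide_horiz {R : RectDiagram} {u w : Torus} (hu : u ∈ R.verts) (hw : w ∈ R.verts)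
    (hne : u ≠ w) (h2 : u.2 = w.2) (σ τ : Bool) :
    ∃ X Y g b g' b', StabAt R X u σ τ g b ∧ StabAt R Y w (!σ) (!τ) g' b' ∧ ExchEquiv X Y := by
  classical
  obtain ⟨a, b⟩ := u
  obtain ⟨c, b'⟩ := w
  obtain rfl : b = b' := h2
  have hac : a ≠ c := by rintro rfl; exact hne rfl
  obtain ⟨γ, hγa, hγ₀, hγ⟩ := exists_small σ a (R.verts.image Prod.fst)
  obtain ⟨β₁, hβ₁b, hβ₁₀, hβ₁⟩ := exists_small τ b (R.verts.image Prod.snd)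
  obtain ⟨β₂, hβ₂b, hβ₂₀, hβ₂⟩ := exists_small (!τ) b (insert β₁ (R.verts.image Prod.snd))
  simp only [Finset.mem_insert, Finset.mem_image, not_or, not_exists, not_and] at hγ₀ hβ₁₀ hβ₂₀
  have t1 : ∀ z ∈ R.verts, z.2 ∈ DirArc τ b β₁ → z.2 = b := fun z hz h => by
    by_contra hzb
    exact (hβ₁ z.2 (Finset.mem_image_of_mem _ hz) hzb).2 h
  have t2 : ∀ z ∈ R.verts, z.2 ∈ DirArc (!τ) b β₂ → z.2 = b := fun z hz h => by
    by_contra hzb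
    exact (hβ₂ z.2 (Finset.mem_insert_of_mem (Finset.mem_image_of_mem _ hz)) hzb).2 h
  have t3 : β₁ ∉ DirArc (!τ) b β₂ := (hβ₂ β₁ (by simp) hβ₁b).2
  have t4 : β₂ ∉ DirArc τ b β₁ := notMem_DirArc_of_notMem_not t3 hβ₂b
  have t5 : c ∉ DirArc σ a γ := (hγ c (Finset.mem_image_of_mem Prod.fst hw) hac.symm).2
  have t6 : a ∉ DirArc (!σ) c γ := notMem_DirArc_not t5 hγa
  have hlev : ∀ z ∈ R.verts, z.2 = b → z = (a, b) ∨ z = (c, b) := by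
    obtain ⟨w, -, -, -, -, h⟩ := R.exists_horiz hu
    have h3 := (h _ hw rfl).resolve_left hne.symm
    rwa [← h3] at h
  have hsgn : R.sgn (a, b) = !R.sgn (c, b) := by
    obtain ⟨w, -, -, -, hs, h⟩ := R.exists_horiz hu
    have h3 := (h _ hw rfl).resolve_left hne.symm
    rw [← h3] at hs
    exact Bool.eq_not.2 hs.symm
  have hcomp : R.comp (a, b) = R.comp (c, b) := R.comp_eq_of_adj hu hw (.inr rfl)
  obtain ⟨X, hX⟩ : ∃ X, StabAt R X (a, b) σ τ γ β₁ :=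
    exists_stabAt hu hγ₀ hβ₁₀ fun z hz h1 h2 => by
      rcases hlev z hz (t1 z hz h2) with rfl | rfl
      · rfl
      · exact absurd h1 t5
  obtain ⟨Y, hY⟩ : ∃ Y, StabAt R Y (c, b) (!σ) (!τ) γ β₂ :=
    exists_stabAt hw hγ₀ hβ₂₀.2 fun z hz h1 h2 => by
      rcases hlev z hz (t2 z hz h2) with rfl | rfl
      · exact absurd h1 t6
      · rfl
  refine ⟨X, Y, γ, β₁, γ, β₂, hX, hY, ?_⟩
  have hγc : γ ≠ c := fun h => hγ₀ _ hw h.symm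
  have hXβ : ∀ z ∈ X.verts, z.2 ≠ β₂ := by
    intro z hz
    rw [hX.mem_iff] at hz
    grind
  have e1 : IsExchange X (X.rename (Equiv.swap b β₂)) := by
    refine isExchange_rename (x := γ) (y := c) (!τ) hγc ?_ ?_ hXβ ?_
    · simp [hX.mem_iff]
    · rw [hX.mem_iff]; grind
    · intro z hz hz2
      rw [hX.mem_iff] at hz
      rcases hz with ⟨hz, -⟩ | rfl | rfl | rfl
      · exact t2 z hz hz2
      · rfl
      · exact absurd hz2 t3
      · exact absurd hz2 t3
  have hm : ∀ z, z ∈ (X.rename (Equiv.swap b β₂)).verts ↔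
      (z ∈ R.verts ∧ z ≠ (a, b) ∧ z ≠ (c, b)) ∨ z = (γ, β₂) ∨ z = (c, β₂) ∨ z = (a, β₁) ∨
        z = (γ, β₁) := by
    rintro ⟨x, y⟩
    rw [RectDiagram.mem_rename, Equiv.symm_swap, hX.mem_iff]
    have := hlev (x, y)
    rcases eq_or_ne y b with rfl | hy
    · rw [Equiv.swap_apply_left]
      grind
    · rcases eq_or_ne y β₂ with rfl | hy'
      · rw [Equiv.swap_apply_right]
        have := hlev (x, b)
        grind
      · rw [Equiv.swap_apply_of_ne_of_ne hy hy']
        grind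
  have e2 : IsExchange (X.rename (Equiv.swap b β₂)) Y := by
    refine isExchange_of_horiz (x := a) (y := γ) (b := β₁) (β := b) true (!τ) hγa.symm hβ₁b
      ?_ ?_ ?_ ?_ ?_ ?_ ?_
    · simp [hm]
    · simp [hm]
    · rw [hm]; grind
    · rw [hm]; grind
    · intro z
      rw [hm, hY.mem_iff]
      grind
    · intro z hz _ hz2
      have hz2 : z.2 ∈ DirArc τ b β₁ := by cases τ <;> exact hz2
      rw [hm] at hz
      rcases hz with ⟨hz, ha, hc⟩ | rfl | rfl | rfl | rfl
      · rcases hlev z hz (t1 z hz hz2) with rfl | rfl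
        · exact absurd rfl ha
        · exact absurd rfl hc
      · exact absurd hz2 t4
      · exact absurd hz2 t4
      · exact .inl rfl
      · exact .inr rfl
    · intro z hz hzY
      rw [hY.mem_iff] at hzY
      rw [RectDiagram.rename_sgn, RectDiagram.rename_comp, Equiv.symm_swap]
      rcases hzY with ⟨hzR, hzc⟩ | rfl | rfl | rfl
      · have hza : z ≠ (a, b) := by
          rintro rfl
          rw [hm] at hz
          grind
        have hzb : z.2 ≠ b := fun h => by
          rcases hlev z hzR h with h | h
          · exact hza h
          · exact hzc h
        rw [Equiv.swap_apply_of_ne_of_ne hzb (hβ₂₀.2 z hzR), (hX.old z hzR hza).1,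
          (hX.old z hzR hza).2, (hY.old z hzR hzc).1, (hY.old z hzR hzc).2]
        exact ⟨rfl, rfl⟩
      · rw [hm] at hz
        grind
      · rw [Equiv.swap_apply_right, hY.vert.1, hY.vert.2]
        exact hX.old _ hw hne.symm
      · rw [Equiv.swap_apply_right, hY.diag.1, hY.diag.2]
        exact ⟨hX.horiz.1.trans hsgn, hX.horiz.2.trans hcomp⟩
  exact .tail (.single e1) e2

lemma exists_slide {R : RectDiagram} {u w : Torus} (h : Adj R.verts u w) (hne : u ≠ w)
    (σ τ : Bool) :
    ∃ X Y g b g' b', StabAt R X u σ τ g b ∧ StabAt R Y w (!σ) (!τ) g' b' ∧ ExchEquiv X Y := by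
  obtain ⟨hu, hw, h | h⟩ := h
  · obtain ⟨X, Y, g, b, g', b', hX, hY, hXY⟩ :=
      exists_slide_horiz (R := R.transpose) (u := u.swap) (w := w.swap) (by simpa) (by simpa)
        (by simpa using hne) h τ σ
    refine ⟨X.transpose, Y.transpose, b, g, b', g', ?_, ?_, hXY.transpose⟩
    · simpa only [RectDiagram.transpose_transpose, Prod.swap_swap] using hX.transpose
    · simpa only [RectDiagram.transpose_transpose, Prod.swap_swap] using hY.transpose
  · exact exists_slide_horiz hu hw hne h σ τ

lemma RectDiagram.sgn_eq_not_of_adj {R : RectDiagram} {u w : Torus} (h : Adj R.verts u w)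
    (hne : u ≠ w) : R.sgn w = !R.sgn u := by
  obtain ⟨hu, hw, h | h⟩ := h
  · obtain ⟨x, -, -, -, hs, hx⟩ := R.exists_vert hu
    rw [(hx w hw h.symm).resolve_left hne.symm]
    exact Bool.eq_not.2 hs
  · obtain ⟨x, -, -, -, hs, hx⟩ := R.exists_horiz hu
    rw [(hx w hw h.symm).resolve_left hne.symm]
    exact Bool.eq_not.2 hs

/-- Two stabilizations of the same oriented type at vertices of the same component have the same
result up to exchange moves. -/
lemma StabAt.exchEquiv_of_conn {R X X' : RectDiagram} {u v : Torus} {σ τ σ' τ' : Bool}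
    {g g' b b' : Real.Angle} (huv : Conn R.verts u v) (h : StabAt R X u σ τ g b)
    (h' : StabAt R X' v σ' τ' g' b') (ht : oType σ τ (R.sgn u) = oType σ' τ' (R.sgn v)) :
    ExchEquiv X X' := by
  induction huv generalizing X' σ' τ' g' b' with
  | refl =>
    obtain ⟨rfl, rfl⟩ := oType_injective ht
    exact h.exchEquiv h'
  | @tail y z _ hyz ih =>
    rcases eq_or_ne y z with rfl | hne
    · exact ih h' ht
    obtain ⟨Y, Z, _, _, _, _, hY, hZ, hYZ⟩ := exists_slide hyz hne (!σ') (!τ')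
    rw [Bool.not_not, Bool.not_not] at hZ
    refine .trans (ih hY ?_) (.trans hYZ (hZ.exchEquiv h'))
    rw [ht, RectDiagram.sgn_eq_not_of_adj hyz hne, ← oType_not (!σ'), Bool.not_not, Bool.not_not]

/-! ### Classification of stabilizations -/

lemma StabAt.isStabOfOType {R X : RectDiagram} {v : Torus} {σ τ : Bool} {g b : Real.Angle}
    (h : StabAt R X v σ τ g b) : IsStabOfOType R X (oType σ τ (R.sgn v)) := by
  have hv := h.mem
  have f1 := h.fresh_fst
  have f2 := h.fresh_snd
  obtain ⟨a, c⟩ := v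
  have hag : a ≠ g := f1 _ hv
  have hcb : c ≠ b := f2 _ hv
  obtain ⟨t1, t2, ht, hta⟩ : ∃ t1 t2, ((σ = true ∧ a = t1 ∧ g = t2) ∨
      (σ = false ∧ a = t2 ∧ g = t1)) ∧ DirArc σ a g = Arc t1 t2 := by
    cases σ
    · exact ⟨g, a, by simp, rfl⟩
    · exact ⟨a, g, by simp, rfl⟩
  obtain ⟨p1, p2, hp, hpa⟩ : ∃ p1 p2, ((τ = true ∧ c = p1 ∧ b = p2) ∨
      (τ = false ∧ c = p2 ∧ b = p1)) ∧ DirArc τ c b = Arc p1 p2 := by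
    cases τ
    · exact ⟨b, c, by simp, rfl⟩
    · exact ⟨c, b, by simp, rfl⟩
  have ma := left_mem_DirArc σ a g
  have mg := right_mem_DirArc σ a g
  have mc := left_mem_DirArc τ c b
  have mb := right_mem_DirArc τ c b
  have he := h.empty
  rw [hta] at he ma mg
  rw [hpa] at he mc mb
  have hcor : ∀ z, z ∈ corners t1 t2 p1 p2 ↔
      z = (a, c) ∨ z = (g, c) ∨ z = (a, b) ∨ z = (g, b) := fun z =>
    mem_corners_iff (by grind) (by grind)
  have hm := h.mem_iff
  have hsd : ∀ z, z ∈ symmDiff R.verts X.verts ↔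
      z = (a, c) ∨ z = (g, c) ∨ z = (a, b) ∨ z = (g, b) := by
    intro z
    rw [Finset.mem_symmDiff, hm]
    grind
  have n1 : (g, c) ∉ R.verts := fun h => f1 _ h rfl
  have n2 : (a, b) ∉ R.verts := fun h => f2 _ h rfl
  have n3 : (g, b) ∉ R.verts := fun h => f1 _ h rfl
  refine ⟨t1, t2, p1, p2, ⟨⟨by grind, by grind, ?_, ⟨(g, c), (g, b), by simp [hsd], by simp [hsd],
    .inr ⟨by simp [hm], by simp [hm], by simpa using hcb, .inl rfl⟩⟩, ?_, ?_, ?_, ?_⟩, ?_⟩,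
    b, by grind, by grind, by grind, ?_⟩
  · ext z
    rw [hsd, hcor]
  · intro hs
    have := (hm _).1 (hs hv)
    grind
  · intro hs
    exact n3 (hs ((hm _).2 (by simp)))
  · ext z
    simp only [Set.mem_inter_iff, RectSet, Set.mem_ofPred_eq, Set.mem_union, Finset.mem_coe, hcor,
      hm]
    constructor
    · rintro ⟨⟨h1, h2⟩, hz⟩
      have := fun h => he z h h1 h2
      tauto
    · rintro (rfl | rfl | rfl | rfl) <;> simp [*]
  · intro z hz
    rw [Finset.mem_inter, hm] at hz
    have hzv : z ≠ (a, c) := by grind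
    exact ⟨(h.old z hz.1 hzv).1.symm, (h.old z hz.1 hzv).2.symm⟩
  · have : X.verts = insert (g, c) (insert (a, b) (insert (g, b) (R.verts.erase (a, c)))) := by
      ext z
      simp only [hm, Finset.mem_insert, Finset.mem_erase]
      tauto
    rw [this, Finset.card_insert_of_notMem (by simp [n1, hag.symm, hcb]),
      Finset.card_insert_of_notMem (by simp [n2, hag]),
      Finset.card_insert_of_notMem (by simp [n3]), Finset.card_erase_of_mem hv]
    have := Finset.card_pos.2 ⟨_, hv⟩
    omega
  · have s1 := h.vert.1
    have s2 := h.diag.1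
    have hC : ∀ z ∈ R.verts, z ∈ corners t1 t2 p1 p2 → z = (a, c) := by
      intro z hz hz'
      rw [hcor] at hz'
      grind
    have hI : σ = τ → TypeICornerCond R t1 t2 p1 p2 := fun hστ z hz hz' => by
      rw [hC z hz hz']
      grind
    have hII : σ = (!τ) → TypeIICornerCond R t1 t2 p1 p2 := fun hστ z hz hz' => by
      rw [hC z hz hz']
      grind
    have hsg : X.sgn (t2, b) = (σ ^^ R.sgn (a, c)) := by
      rcases ht with ⟨rfl, rfl, rfl⟩ | ⟨rfl, rfl, rfl⟩
      · simpa using s2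
      · simpa using s1
    rw [hsg]
    generalize R.sgn (a, c) = s
    clear * - hI hII
    cases σ <;> cases τ <;> cases s <;> simp [oType] at hI hII ⊢ <;> assumption

lemma StabAt.modifiesComp_iff {R X : RectDiagram} {v : Torus} {σ τ : Bool} {g b : Real.Angle}
    (h : StabAt R X v σ τ g b) {i : ℕ} : ModifiesComp R X i ↔ R.comp v = i := by
  constructor
  · rintro ⟨z, hz, hzX, rfl⟩
    by_cases hzv : z = v
    · rw [hzv]
    · exact absurd ((h.mem_iff z).2 (.inl ⟨hz, hzv⟩)) hzX
  · rintro rfl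
    refine ⟨v, h.mem, fun hv => ?_, rfl⟩
    have := h.fresh_fst v h.mem
    have := h.fresh_snd v h.mem
    rw [h.mem_iff] at hv
    grind

lemma exists_eq_sdiff_of_isStabWith {R X : RectDiagram} {t1 t2 p1 p2 : Real.Angle}
    (h : IsStabWith R X t1 t2 p1 p2) : ∃ v, R.verts \ X.verts = {v} := by
  classical
  obtain ⟨⟨ht, hp, hd, -⟩, hc⟩ := h
  rw [← Finset.card_eq_one]
  have h4 : (corners t1 t2 p1 p2).card = 4 := by
    rw [corners, Finset.card_insert_of_notMem (by simp [ht, hp]),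
      Finset.card_insert_of_notMem (by simp [ht]),
      Finset.card_insert_of_notMem (by simp [hp]), Finset.card_singleton]
  have h5 : (R.verts \ X.verts).card + (X.verts \ R.verts).card = 4 := by
    rw [← h4, ← hd, ← Finset.card_union_of_disjoint disjoint_sdiff_sdiff]
    rfl
  have h6 := Finset.card_sdiff_add_card_inter R.verts X.verts
  have h7 := Finset.card_sdiff_add_card_inter X.verts R.verts
  rw [Finset.inter_comm] at h7
  omega

lemma exists_stabAt_of_isStabOfOType {R X : RectDiagram} {t : OType}
    (h : IsStabOfOType R X t) :
    ∃ v σ τ g b, StabAt R X v σ τ g b ∧ oType σ τ (R.sgn v) = t := by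
  obtain ⟨t1, t2, p1, p2, hst, p0, hp0, hx1, hx2, hty⟩ := h
  obtain ⟨v, hRX⟩ := exists_eq_sdiff_of_isStabWith hst
  obtain ⟨⟨htne, hpne, hd, -, -, -, hr, ho⟩, -⟩ := hst
  have hvm : v ∈ R.verts ∧ v ∉ X.verts := by
    rw [← Finset.mem_sdiff, hRX, Finset.mem_singleton]
  have hRX' : ∀ z, z ∈ R.verts → z ∉ X.verts → z = v := fun z h1 h2 => by
    rw [← Finset.mem_singleton, ← hRX, Finset.mem_sdiff]
    exact ⟨h1, h2⟩
  have hd' : ∀ z, z ∈ corners t1 t2 p1 p2 ↔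
      (z ∈ R.verts ∧ z ∉ X.verts) ∨ (z ∈ X.verts ∧ z ∉ R.verts) := fun z => by
    rw [← hd, Finset.mem_symmDiff]
  have hvc := (hd' v).2 (.inl hvm)
  obtain ⟨a, c⟩ := v
  have ha : a = t1 ∨ a = t2 := by simp [corners] at hvc; tauto
  have hc : c = p1 ∨ c = p2 := by simp [corners] at hvc; tauto
  obtain ⟨σ, g, hσ, hσa⟩ : ∃ σ g, ((σ = true ∧ a = t1 ∧ g = t2) ∨
      (σ = false ∧ a = t2 ∧ g = t1)) ∧ DirArc σ a g = Arc t1 t2 := by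
    rcases ha with rfl | rfl
    · exact ⟨true, t2, by simp, rfl⟩
    · exact ⟨false, t1, by simp, rfl⟩
  obtain ⟨τ, b, hτ, hτa⟩ : ∃ τ b, ((τ = true ∧ c = p1 ∧ b = p2) ∨
      (τ = false ∧ c = p2 ∧ b = p1)) ∧ DirArc τ c b = Arc p1 p2 := by
    rcases hc with rfl | rfl
    · exact ⟨true, p2, by simp, rfl⟩
    · exact ⟨false, p1, by simp, rfl⟩
  have hag : a ≠ g := by grind
  have hcb : c ≠ b := by grind
  have hcor : ∀ z, z ∈ corners t1 t2 p1 p2 ↔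
      z = (a, c) ∨ z = (g, c) ∨ z = (a, b) ∨ z = (g, b) := fun z =>
    mem_corners_iff (by grind) (by grind)
  have hnew : ∀ z ∈ corners t1 t2 p1 p2, z ≠ (a, c) → z ∈ X.verts ∧ z ∉ R.verts := by
    intro z hz hzv
    exact ((hd' z).1 hz).resolve_left fun h => hzv (hRX' z h.1 h.2)
  have m1 := hnew (g, c) (by simp [hcor]) (by simpa using hag.symm)
  have m2 := hnew (a, b) (by simp [hcor]) (by simpa using hcb.symm)
  have m3 := hnew (g, b) (by simp [hcor]) (by simp [hag.symm])
  have hX : StabAt R X (a, c) σ τ g b := by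
    refine .of_mem_iff hvm.1 hag hcb m1.2 m2.2 m3.2 ?_ ?_ ?_
    · intro z hz h1 h2
      rw [hσa] at h1
      rw [hτa] at h2
      have hzc : z ∈ corners t1 t2 p1 p2 := by
        rw [← Finset.mem_coe, ← hr]
        exact ⟨⟨h1, h2⟩, .inl hz⟩
      by_contra hne
      exact (hnew z hzc hne).2 hz
    · intro z
      have h1 := hd' z
      have h2 := hRX' z
      rw [hcor] at h1
      grind
    · intro z hz hzv
      have hzX : z ∈ X.verts := by
        by_contra hzX
        exact hzv (hRX' z hz hzX)
      have := ho z (Finset.mem_inter.2 ⟨hz, hzX⟩)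
      exact ⟨this.1.symm, this.2.symm⟩
  refine ⟨(a, c), σ, τ, g, b, hX, ?_⟩
  have hp0b : p0 = b := by
    have : p0 ≠ c := by
      rintro rfl
      rcases ha with rfl | rfl
      · exact hvm.2 hx1
      · exact hvm.2 hx2
    grind
  subst hp0b
  have s1 := hX.vert.1
  have s2 := hX.diag.1
  have hI : TypeICornerCond R t1 t2 p1 p2 → σ = τ := fun h => by
    have := h _ hvm.1 hvc
    grind
  have hII : TypeIICornerCond R t1 t2 p1 p2 → σ = !τ := fun h => by
    have := h _ hvm.1 hvc
    grind
  have hsg : X.sgn (t2, p0) = (σ ^^ R.sgn (a, c)) := by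
    rcases hσ with ⟨rfl, rfl, rfl⟩ | ⟨rfl, rfl, rfl⟩
    · simpa using s2
    · simpa using s1
  rw [hsg] at hty
  generalize R.sgn (a, c) = s at hty
  clear hX hσ hσa hτ hτa s1 s2 hsg
  cases t <;> obtain ⟨hT, hs⟩ := hty
  · obtain rfl := hI hT
    revert hs; cases σ <;> cases s <;> decide
  · obtain rfl := hI hT
    revert hs; cases σ <;> cases s <;> decide
  · obtain rfl := hII hT
    revert hs; cases τ <;> cases s <;> decide
  · obtain rfl := hII hT
    revert hs; cases τ <;> cases s <;> decide

/-! ### Stabilizations and elementary moves -/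

/-- An elementary move does not replace all vertices of any component. -/
lemma IsElemMoveWith.exists_common {R₁ R₂ : RectDiagram} {t1 t2 p1 p2 : Real.Angle}
    (h : IsElemMoveWith R₁ R₂ t1 t2 p1 p2) {v : Torus} (hv : v ∈ R₂.verts) :
    ∃ w ∈ R₁.verts, w ∈ R₂.verts ∧ R₂.comp w = R₂.comp v := by
  obtain ⟨-, -, hd, -, hsub, -⟩ := h
  by_contra! hno
  have hcor : ∀ z ∈ R₂.verts, R₂.comp z = R₂.comp v → (z.1 = t1 ∨ z.1 = t2) ∧
      (z.2 = p1 ∨ z.2 = p2) := by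
    intro z hz hzc
    have : z ∈ corners t1 t2 p1 p2 := by
      rw [← hd, Finset.mem_symmDiff]
      exact .inr ⟨hz, fun h => hno z h hz hzc⟩
    simp only [corners, Finset.mem_insert, Finset.mem_singleton] at this
    rcases this with rfl | rfl | rfl | rfl <;> simp
  obtain ⟨a, ha, hav, ha2, -⟩ := R₂.exists_horiz hv
  obtain ⟨b, hb, hbv, hb1, -⟩ := R₂.exists_vert hv
  obtain ⟨c, hc, hcb, hc2, -⟩ := R₂.exists_horiz hb
  have ca := R₂.comp_eq_of_adj ha hv (.inr ha2)
  have cb := R₂.comp_eq_of_adj hb hv (.inl hb1)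
  have cc := (R₂.comp_eq_of_adj hc hb (.inr hc2)).trans cb
  have kv := hcor v hv rfl
  have ka := hcor a ha ca
  have kb := hcor b hb cb
  have kc := hcor c hc cc
  have na : a.1 ≠ v.1 := fun h => hav (Prod.ext h ha2)
  have nb : b.2 ≠ v.2 := fun h => hbv (Prod.ext hb1 h)
  have nc : c.1 ≠ b.1 := fun h => hcb (Prod.ext h hc2)
  refine hsub fun z hz => ?_
  by_contra hz2
  have hzc : z ∈ corners t1 t2 p1 p2 := by
    rw [← hd, Finset.mem_symmDiff]
    exact .inl ⟨hz, hz2⟩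
  have kz : (z.1 = t1 ∨ z.1 = t2) ∧ (z.2 = p1 ∨ z.2 = p2) := by
    simp only [corners, Finset.mem_insert, Finset.mem_singleton] at hzc
    rcases hzc with rfl | rfl | rfl | rfl <;> simp
  have h1 : z.1 = v.1 ∨ z.1 = a.1 := by grind
  have h2 : z.2 = v.2 ∨ z.2 = b.2 := by grind
  have h3 : c.1 = a.1 := by grind
  have : z = v ∨ z = a ∨ z = b ∨ z = c := by
    rcases h1 with h1 | h1 <;> rcases h2 with h2 | h2
    · exact .inl (Prod.ext h1 h2)
    · exact .inr (.inr (.inl (Prod.ext (h1.trans hb1.symm) h2)))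
    · exact .inr (.inl (Prod.ext h1 (h2.trans ha2.symm)))
    · exact .inr (.inr (.inr (Prod.ext (h1.trans h3.symm) (h2.trans hc2.symm))))
  rcases this with rfl | rfl | rfl | rfl <;> contradiction

lemma IsElemMoveWith.notMem_rectSet {R₁ R₂ : RectDiagram} {t1 t2 p1 p2 : Real.Angle}
    (h : IsElemMoveWith R₁ R₂ t1 t2 p1 p2) {w : Torus} (h1 : w ∈ R₁.verts) (h2 : w ∈ R₂.verts) :
    w ∉ RectSet t1 t2 p1 p2 := by
  obtain ⟨-, -, hd, -, -, -, hr, -⟩ := h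
  intro hw
  have : w ∈ corners t1 t2 p1 p2 := by
    rw [← Finset.mem_coe, ← hr]
    exact ⟨hw, .inl h1⟩
  rw [← hd, Finset.mem_symmDiff] at this
  tauto

/-- An elementary move can be repeated after a stabilization at a common vertex that avoids
the rectangle of the move. -/
lemma IsElemMoveWith.doesSameThing {R₁ R₂ X₁ X₂ : RectDiagram} {t1 t2 p1 p2 : Real.Angle}
    (h : IsElemMoveWith R₁ R₂ t1 t2 p1 p2) {w : Torus} {σ τ : Bool} {g b : Real.Angle}
    (h₁ : StabAt R₁ X₁ w σ τ g b) (h₂ : StabAt R₂ X₂ w σ τ g b)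
    (hn : ∀ x y, (x, y) = (g, w.2) ∨ (x, y) = (w.1, b) ∨ (x, y) = (g, b) →
      (x, y) ∉ RectSet t1 t2 p1 p2) :
    DoesSameThing R₁ R₂ X₁ X₂ t1 t2 p1 p2 := by
  have m₁ := h₁.mem
  have m₂ := h₂.mem
  have i₁ := h₁.mem_iff
  have i₂ := h₂.mem_iff
  obtain ⟨ht, hp, hd, ⟨u, v, hu, hv, he⟩, hs1, hs2, hr, ho⟩ := h
  have n₁ : ∀ z, z = (g, w.2) ∨ z = (w.1, b) ∨ z = (g, b) → z ∉ R₁.verts := by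
    rintro z (rfl | rfl | rfl) hz
    · exact h₁.fresh_fst _ hz rfl
    · exact h₁.fresh_snd _ hz rfl
    · exact h₁.fresh_fst _ hz rfl
  have n₂ : ∀ z, z = (g, w.2) ∨ z = (w.1, b) ∨ z = (g, b) → z ∉ R₂.verts := by
    rintro z (rfl | rfl | rfl) hz
    · exact h₂.fresh_fst _ hz rfl
    · exact h₂.fresh_snd _ hz rfl
    · exact h₂.fresh_fst _ hz rfl
  have d₁ : ∀ z, z ∈ X₁.verts ∧ z ∉ X₂.verts ↔ z ∈ R₁.verts ∧ z ∉ R₂.verts := by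
    intro z
    have := n₁ z
    have := n₂ z
    rw [i₁, i₂]
    grind
  have d₂ : ∀ z, z ∈ X₂.verts ∧ z ∉ X₁.verts ↔ z ∈ R₂.verts ∧ z ∉ R₁.verts := by
    intro z
    have := n₁ z
    have := n₂ z
    rw [i₁, i₂]
    grind
  have hd' : symmDiff X₁.verts X₂.verts = symmDiff R₁.verts R₂.verts := by
    ext z
    rw [Finset.mem_symmDiff, Finset.mem_symmDiff, d₁, d₂]
  have hw : w ∉ symmDiff R₁.verts R₂.verts := by
    rw [Finset.mem_symmDiff]
    tauto
  have hne : ∀ z ∈ symmDiff R₁.verts R₂.verts, z ≠ w := fun z hz hzw => hw (hzw ▸ hz)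
  have o₁ : ∀ z, z ∈ R₁.verts → z ∉ R₂.verts → X₁.sgn z = R₁.sgn z ∧ X₁.comp z = R₁.comp z :=
    fun z h h' => h₁.old z h fun hz => h' (hz ▸ m₂)
  have o₂ : ∀ z, z ∈ R₂.verts → z ∉ R₁.verts → X₂.sgn z = R₂.sgn z ∧ X₂.comp z = R₂.comp z :=
    fun z h h' => h₂.old z h fun hz => h' (hz ▸ m₁)
  have how := ho w (Finset.mem_inter.2 ⟨m₁, m₂⟩)
  refine ⟨⟨ht, hp, hd'.trans hd, ⟨u, v, by rwa [hd'], by rwa [hd'], ?_⟩, ?_, ?_, ?_, ?_⟩, ?_, ?_,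
    ?_, ?_, ?_⟩
  · refine he.imp ?_ ?_ <;> rintro ⟨a1, a2, a3⟩
    · exact ⟨(i₁ u).2 (.inl ⟨a1, hne u hu⟩), (i₁ v).2 (.inl ⟨a2, hne v hv⟩), a3⟩
    · exact ⟨(i₂ u).2 (.inl ⟨a1, hne u hu⟩), (i₂ v).2 (.inl ⟨a2, hne v hv⟩), a3⟩
  · intro hX
    refine hs1 fun z hz => ?_
    by_contra hz2
    have := (d₁ z).2 ⟨hz, hz2⟩
    exact this.2 (hX this.1)
  · intro hX
    refine hs2 fun z hz => ?_
    by_contra hz2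
    have := (d₂ z).2 ⟨hz, hz2⟩
    exact this.2 (hX this.1)
  · rw [← hr]
    ext z
    simp only [Set.mem_inter_iff, Set.mem_union, Finset.mem_coe]
    refine and_congr_right fun hz => ?_
    have h1 := hn z.1 z.2
    have h2 : w ∉ RectSet t1 t2 p1 p2 := by
      intro hwr
      apply hw
      rw [hd, ← Finset.mem_coe, ← hr]
      exact ⟨hwr, .inl m₁⟩
    have h3 : z ≠ w := fun h => h2 (h ▸ hz)
    rw [i₁, i₂]
    tauto
  · intro z hz
    rw [Finset.mem_inter, i₁, i₂] at hz
    by_cases hz' : z = (g, w.2) ∨ z = (w.1, b) ∨ z = (g, b)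
    · rcases hz' with rfl | rfl | rfl
      · rw [h₁.horiz.1, h₁.horiz.2, h₂.horiz.1, h₂.horiz.2]
        exact how
      · rw [h₁.vert.1, h₁.vert.2, h₂.vert.1, h₂.vert.2]
        exact how
      · rw [h₁.diag.1, h₁.diag.2, h₂.diag.1, h₂.diag.2, how.1]
        exact ⟨rfl, how.2⟩
    · obtain ⟨hz1, hz2⟩ := And.intro (hz.1.resolve_right hz') (hz.2.resolve_right hz')
      rw [(h₁.old z hz1.1 hz1.2).1, (h₁.old z hz1.1 hz1.2).2, (h₂.old z hz2.1 hz1.2).1,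
        (h₂.old z hz2.1 hz1.2).2]
      exact ho z (Finset.mem_inter.2 ⟨hz1.1, hz2.1⟩)
  · ext z
    rw [Finset.mem_sdiff, Finset.mem_sdiff, d₁]
  · ext z
    rw [Finset.mem_sdiff, Finset.mem_sdiff, d₂]
  · intro z hz
    rw [Finset.mem_sdiff] at hz
    exact (o₁ z hz.1 hz.2).1
  · intro z hz
    rw [Finset.mem_sdiff] at hz
    exact (o₂ z hz.1 hz.2).1
  · refine fun i => exists_congr fun z => ?_
    have := d₁ z
    have := o₁ z
    grind

lemma exists_stabAt_both {R₁ R₂ : RectDiagram} {t1 t2 p1 p2 : Real.Angle}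
    (h : IsElemMoveWith R₁ R₂ t1 t2 p1 p2) {w : Torus} (h1 : w ∈ R₁.verts) (h2 : w ∈ R₂.verts)
    (σ τ : Bool) :
    ∃ X₁ X₂ g b, StabAt R₁ X₁ w σ τ g b ∧ StabAt R₂ X₂ w σ τ g b ∧
      DoesSameThing R₁ R₂ X₁ X₂ t1 t2 p1 p2 := by
  classical
  obtain ⟨g, -, hg₀, hg⟩ := exists_small σ w.1
    (insert t1 (insert t2 ((R₁.verts ∪ R₂.verts).image Prod.fst)))
  obtain ⟨b, -, hb₀, hb⟩ := exists_small τ w.2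
    (insert p1 (insert p2 ((R₁.verts ∪ R₂.verts).image Prod.snd)))
  simp only [Finset.mem_insert, Finset.mem_image, Finset.mem_union, not_or, not_exists,
    not_and] at hg₀ hb₀
  have e : ∀ z ∈ R₁.verts ∪ R₂.verts, z.1 ∈ DirArc σ w.1 g → z.2 ∈ DirArc τ w.2 b → z = w := by
    intro z hz hz1 hz2
    refine Prod.ext ?_ ?_ <;> by_contra hne
    · refine (hg z.1 ?_ hne).2 hz1
      exact Finset.mem_insert_of_mem (Finset.mem_insert_of_mem (Finset.mem_image_of_mem _ hz))
    · refine (hb z.2 ?_ hne).2 hz2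
      exact Finset.mem_insert_of_mem (Finset.mem_insert_of_mem (Finset.mem_image_of_mem _ hz))
  obtain ⟨X₁, hX₁⟩ : ∃ X, StabAt R₁ X w σ τ g b :=
    exists_stabAt h1 (fun z hz => hg₀.2.2 z (.inl hz)) (fun z hz => hb₀.2.2 z (.inl hz))
      fun z hz => e z (Finset.mem_union_left _ hz)
  obtain ⟨X₂, hX₂⟩ : ∃ X, StabAt R₂ X w σ τ g b :=
    exists_stabAt h2 (fun z hz => hg₀.2.2 z (.inr hz)) (fun z hz => hb₀.2.2 z (.inr hz))
      fun z hz => e z (Finset.mem_union_right _ hz)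
  refine ⟨X₁, X₂, g, b, hX₁, hX₂, h.doesSameThing hX₁ hX₂ ?_⟩
  have hw := h.notMem_rectSet h1 h2
  have hgA : w.1 ∉ Arc t1 t2 → g ∉ Arc t1 t2 := by
    intro hw1 hgA
    have l := left_mem_DirArc true t1 t2
    have r := right_mem_DirArc true t1 t2
    rcases mem_DirArc_of_notMem_Arc (σ := σ) hw1 hgA with h' | h'
    · exact (hg t1 (by simp) fun h => hw1 (h ▸ l)).2 h'
    · exact (hg t2 (by simp) fun h => hw1 (h ▸ r)).2 h'
  have hbA : w.2 ∉ Arc p1 p2 → b ∉ Arc p1 p2 := by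
    intro hw1 hgA
    have l := left_mem_DirArc true p1 p2
    have r := right_mem_DirArc true p1 p2
    rcases mem_DirArc_of_notMem_Arc (σ := τ) hw1 hgA with h' | h'
    · exact (hb p1 (by simp) fun h => hw1 (h ▸ l)).2 h'
    · exact (hb p2 (by simp) fun h => hw1 (h ▸ r)).2 h'
  intro x y hxy
  simp only [Prod.mk.injEq] at hxy
  by_cases hw1 : w.1 ∈ Arc t1 t2
  · have hw2 : w.2 ∉ Arc p1 p2 := fun hw2 => hw ⟨hw1, hw2⟩
    have hb2 := hbA hw2
    rintro ⟨-, hy⟩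
    rcases hxy with ⟨-, rfl⟩ | ⟨-, rfl⟩ | ⟨-, rfl⟩
    exacts [hw2 hy, hb2 hy, hb2 hy]
  · have hg2 := hgA hw1
    rintro ⟨hx, -⟩
    rcases hxy with ⟨rfl, -⟩ | ⟨rfl, -⟩ | ⟨rfl, -⟩
    exacts [hg2 hx, hw1 hx, hg2 hx]

/-- If `R₁ ↦ R₂` is an elementary move and `R₂ ↦ R₃` is a stabilization (of oriented type
`t`, on the component number `i`), then there is a chain `R₁ ↦ R₂' ↦ R₃' ↦ ⋯ ↦ R₃` where
`R₁ ↦ R₂'` is a stabilization of the same oriented type modifying the component with the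
same number, `R₂' ↦ R₃'` does the same thing as `R₁ ↦ R₂`, and all remaining moves are
exchange moves. -/
theorem stab_moves_first (R₁ R₂ R₃ : RectDiagram) (t1 t2 p1 p2 : Real.Angle)
    (hmv : IsElemMoveWith R₁ R₂ t1 t2 p1 p2) (t : OType) (i : ℕ)
    (hstab : IsStabOfOType R₂ R₃ t) (hcomp : ModifiesComp R₂ R₃ i) :
    ∃ R₂' R₃' : RectDiagram,
      IsStabOfOType R₁ R₂' t ∧ ModifiesComp R₁ R₂' i ∧
      DoesSameThing R₁ R₂ R₂' R₃' t1 t2 p1 p2 ∧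
      Relation.ReflTransGen IsExchange R₃' R₃ := by
  obtain ⟨v, σ₀, τ₀, g₀, b₀, hR₃, rfl⟩ := exists_stabAt_of_isStabOfOType hstab
  obtain rfl := hR₃.modifiesComp_iff.1 hcomp
  obtain ⟨w, hw₁, hw₂, hwv⟩ := hmv.exists_common hR₃.mem
  obtain ⟨σ, τ, hστ⟩ := exists_oType_eq (oType σ₀ τ₀ (R₂.sgn v)) (R₂.sgn w)
  obtain ⟨X₁, X₂, g, b, hX₁, hX₂, hX⟩ := exists_stabAt_both hmv hw₁ hw₂ σ τ
  have hw : R₁.sgn w = R₂.sgn w ∧ R₁.comp w = R₂.comp w :=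
    hmv.2.2.2.2.2.2.2 w (Finset.mem_inter.2 ⟨hw₁, hw₂⟩)
  refine ⟨X₁, X₂, ?_, hX₁.modifiesComp_iff.2 (hw.2.trans hwv), hX,
    hX₂.exchEquiv_of_conn ((R₂.comp_eq_iff_conn hw₂ hR₃.mem).1 hwv) hR₃ hστ⟩
  rw [← hστ, ← hw.1]
  exact hX₁.isStabOfOType

end RectDiag
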